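/- arXiv:0810.3255 — 3 statements merged into one kernel-verified Lean document; each statement's English description precedes it below -/
import Mathlib

section
/- Let R₀ > 0, θ ∈ [0,1], δ₁ ∈ (0,1/2], and let g : ℝ → ℝ be a smooth function with 0 ≤ g ≤ 1, g(t) = 0 for t ≤ 0, and g(t) = 1 for t ≥ δ₁/2. For R > 0 define φ^R : ℝ² → ℝ by φ^R(x) = g(R^{−θ}(R − |x|)). Let ω : ℝ² → ℝ be continuously differentiable with support contained in B(0,R₀), set m = ∫_{ℝ²} ω, let u(x) = (1/(2π)) ∫_{ℝ²} ((x−y)^⊥/|x−y|²) ω(y) dy, let ψ_R(x) = (1/(2π)) ∫_{ℝ²} log|x−y| ω(y) dy − (m/(2π)) log R, and let T_R u = ∇^⊥(φ^R ψ_R). Then there exists a constant C > 0, depending only on R₀, θ, δ₁ and g, such that for every R ≥ max(4R₀, 1): ‖D(T_R u)‖_{L²(B(0,R))} ≤ C ‖ω‖_{L²(ℝ²)}, where D denotes the (Fréchet) derivative. -/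
open MeasureTheory Real

/-- The perpendicular `z^⊥ = (-z₂, z₁)` of a vector in `ℝ²`. -/
noncomputable def perp (z : EuclideanSpace ℝ (Fin 2)) : EuclideanSpace ℝ (Fin 2) :=
  (EuclideanSpace.equiv (Fin 2) ℝ).symm ![-z 1, z 0]

/-- The perpendicular gradient `∇^⊥ f = (−∂₂f, ∂₁f)` of a scalar function on `ℝ²`. -/
noncomputable def perpGrad (f : EuclideanSpace ℝ (Fin 2) → ℝ)
    (x : EuclideanSpace ℝ (Fin 2)) : EuclideanSpace ℝ (Fin 2) :=
  (EuclideanSpace.equiv (Fin 2) ℝ).symm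
    ![-(fderiv ℝ f x (EuclideanSpace.single 1 1)),
      fderiv ℝ f x (EuclideanSpace.single 0 1)]

/-- The two-dimensional Biot–Savart law
`u(x) = (1/(2π)) ∫ ((x−y)^⊥/|x−y|²) ω(y) dy`. -/
noncomputable def biotSavart2D (ω : EuclideanSpace ℝ (Fin 2) → ℝ)
    (x : EuclideanSpace ℝ (Fin 2)) : EuclideanSpace ℝ (Fin 2) :=
  (1 / (2 * π)) • ∫ y, (ω y / ‖x - y‖ ^ 2) • perp (x - y)

/-- The stream function of `ω` normalized so that it vanishes at `|x| = R`
when `ω` is radial: `ψ_R(x) = (1/(2π)) ∫ log|x−y| ω(y) dy − (m/(2π)) log R`. -/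
noncomputable def streamR (ω : EuclideanSpace ℝ (Fin 2) → ℝ) (m R : ℝ)
    (x : EuclideanSpace ℝ (Fin 2)) : ℝ :=
  (1 / (2 * π)) * (∫ y, Real.log ‖x - y‖ * ω y) - (m / (2 * π)) * Real.log R

/-- The boundary-layer cutoff `φ^R(x) = g(R^{−θ}(R − |x|))`. -/
noncomputable def cutoff (g : ℝ → ℝ) (θ R : ℝ) (x : EuclideanSpace ℝ (Fin 2)) : ℝ :=
  g (R ^ (-θ) * (R - ‖x‖))

/-- The truncation operator `T_R u = ∇^⊥(φ^R ψ_R)`. -/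
noncomputable def truncate (g : ℝ → ℝ) (θ R : ℝ) (ω : EuclideanSpace ℝ (Fin 2) → ℝ)
    (m : ℝ) : EuclideanSpace ℝ (Fin 2) → EuclideanSpace ℝ (Fin 2) :=
  perpGrad (fun x => cutoff g θ R x * streamR ω m R x)


abbrev E2 := EuclideanSpace ℝ (Fin 2)

noncomputable def cvv (f h : E2 → ℝ) (x : E2) : ℝ := ∫ t, f t * h (x - t)

lemma cvv_eq (f h : E2 → ℝ) :
    cvv f h = convolution f h (ContinuousLinearMap.mul ℝ ℝ) volume := by
  ext x; simp [cvv, convolution_def]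

lemma cvv_hasFDerivAt {f h : E2 → ℝ} (hf : LocallyIntegrable f volume) (hh : ContDiff ℝ 1 h)
    (hc : HasCompactSupport h) :
    ContDiff ℝ 1 (cvv f h) ∧ ∀ x v, fderiv ℝ (cvv f h) x v = cvv f (fun z => fderiv ℝ h z v) x := by
  constructor
  · rw [cvv_eq]
    exact hc.contDiff_convolution_right _ hf hh
  · intro x v
    rw [cvv_eq, cvv_eq, (hc.hasFDerivAt_convolution_right _ hf hh x).fderiv]
    rw [convolution_precompR_apply _ hf (hc.fderiv ℝ) (hh.continuous_fderiv one_ne_zero)]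

lemma cs_comp_sub {h : E2 → ℝ} (hc : HasCompactSupport h) (x : E2) :
    HasCompactSupport (fun t => h (x - t)) :=
  hc.comp_homeomorph (Homeomorph.subLeft x)

lemma li_mul_integrable {f h : E2 → ℝ} (hf : LocallyIntegrable f volume) (hh : Continuous h)
    (hc : HasCompactSupport h) (x : E2) : Integrable (fun t => f t * h (x - t)) volume := by
  have := hf.integrable_smul_right_of_hasCompactSupport (g := fun t => h (x - t))
    (by fun_prop) (cs_comp_sub hc x)
  simpa using this

lemma contDiff_two_of {f : E2 → ℝ} (hf : Differentiable ℝ f)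
    (h : ∀ v, ContDiff ℝ 1 (fun x => fderiv ℝ f x v)) : ContDiff ℝ 2 f := by
  have : (2 : WithTop ℕ∞) = 1 + 1 := by norm_num
  rw [this, contDiff_succ_iff_fderiv_apply]
  exact ⟨hf, by simp, h⟩

lemma fderiv_sub_left {h : E2 → ℝ} (hh : ContDiff ℝ 1 h) (x t v : E2) :
    fderiv ℝ (fun t => h (x - t)) t v = - fderiv ℝ h (x - t) v := by
  have h1 : HasFDerivAt h (fderiv ℝ h (x - t)) (x - t) :=
    (hh.differentiable one_ne_zero _).hasFDerivAt
  have h2 : HasFDerivAt (fun t : E2 => x - t) (-(ContinuousLinearMap.id ℝ E2)) t := by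
    simpa using (hasFDerivAt_id t).const_sub x
  have h3 := h1.comp t h2
  have h4 : fderiv ℝ (fun t => h (x - t)) t = _ := h3.fderiv
  rw [h4]; simp

lemma cvv_ibp {f h : E2 → ℝ} (hf : ContDiff ℝ 1 f) (hh : ContDiff ℝ 1 h)
    (hc : HasCompactSupport h) (x v : E2) :
    cvv f (fun z => fderiv ℝ h z v) x = cvv (fun z => fderiv ℝ f z v) h x := by
  have hcf : Continuous f := hf.continuous
  have hcf' : Continuous (fun z => fderiv ℝ f z v) :=
    (hf.continuous_fderiv one_ne_zero).clm_apply continuous_const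
  have hch' : Continuous (fun z => fderiv ℝ h z v) :=
    (hh.continuous_fderiv one_ne_zero).clm_apply continuous_const
  have hc' : HasCompactSupport (fun z => fderiv ℝ h z v) := hc.fderiv_apply ℝ v
  have key := integral_mul_fderiv_eq_neg_fderiv_mul_of_integrable (μ := (volume : Measure E2))
    (f := f) (g := fun t => h (x - t)) (v := v)
    (li_mul_integrable hcf'.locallyIntegrable hh.continuous hc x)
    (by
      have := (li_mul_integrable hcf.locallyIntegrable hch' hc' x).neg
      refine this.congr (Filter.Eventually.of_forall fun t => ?_)
      simp [fderiv_sub_left hh])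
    (li_mul_integrable hcf.locallyIntegrable hh.continuous hc x)
    (fun z _ => hf.differentiable one_ne_zero z)
    (fun z _ => (hh.differentiable one_ne_zero _).comp z (by fun_prop))
  simp only [fderiv_sub_left hh, mul_neg, integral_neg] at key
  unfold cvv
  linarith

/-- swapping derivatives -/
lemma swap_deriv {G H : E2 → ℝ} (hG : ContDiff ℝ 1 G) (hGc : HasCompactSupport G)
    (hH : ContDiff ℝ 1 H) (hHc : HasCompactSupport H) (v w : E2) :
    ∫ x, fderiv ℝ G x v * fderiv ℝ H x w = ∫ x, fderiv ℝ G x w * fderiv ℝ H x v := by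
  have hH' : ContDiff ℝ 1 (fun t => H (0 - t)) := hH.comp (by fun_prop)
  have hHc' : HasCompactSupport (fun t => H (0 - t)) := cs_comp_sub hHc 0
  set K : E2 → ℝ := fun t => H (0 - t) with hK
  have hGd : ∀ v, Continuous (fun z => fderiv ℝ G z v) := fun v =>
    (hG.continuous_fderiv one_ne_zero).clm_apply continuous_const
  obtain ⟨h1, h2⟩ := cvv_hasFDerivAt hG.continuous.locallyIntegrable hH' hHc'
  have h3 : ∀ v, (fun x => fderiv ℝ (cvv G K) x v) = cvv (fun z => fderiv ℝ G z v) K := by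
    intro v; ext x; rw [h2, cvv_ibp hG hH' hHc']
  have h4 := fun v => cvv_hasFDerivAt (hGd v).locallyIntegrable hH' hHc'
  have h5 : ContDiff ℝ 2 (cvv G K) := contDiff_two_of (h1.differentiable one_ne_zero)
    (fun v => by rw [h3]; exact (h4 v).1)
  have hs : IsSymmSndFDerivAt ℝ (cvv G K) 0 := h5.contDiffAt.isSymmSndFDerivAt (by simp)
  have h6 : ∀ v w, fderiv ℝ (fderiv ℝ (cvv G K)) 0 w v =
      - ∫ x, fderiv ℝ G x v * fderiv ℝ H x w := by
    intro v w
    have hd : DifferentiableAt ℝ (fderiv ℝ (cvv G K)) 0 :=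
      (h5.fderiv_right (m := 1) (by norm_num)).differentiable one_ne_zero 0
    have : fderiv ℝ (fun x => fderiv ℝ (cvv G K) x v) 0 w =
        fderiv ℝ (fderiv ℝ (cvv G K)) 0 w v := by
      rw [fderiv_clm_apply hd (by fun_prop)]; simp
    rw [← this, h3, (h4 v).2]
    unfold cvv
    simp only [hK, fderiv_sub_left hH, mul_neg, integral_neg, sub_sub_cancel]
  have := hs v w
  rw [h6, h6] at this
  linarith



lemma li_inv : LocallyIntegrable (fun x : E2 => ‖x‖⁻¹) volume := by
  rw [locallyIntegrable_iff]
  intro k hk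
  obtain ⟨r, hr⟩ := hk.isBounded.subset_ball (0 : E2)
  refine IntegrableOn.mono_set ?_ hr
  rw [integrableOn_fun_norm_addHaar (μ := volume) (f := fun y : ℝ => y⁻¹)]
  have : IntegrableOn (fun _ : ℝ => (1:ℝ)) (Set.Ioo 0 r) volume := by
    simp [integrableOn_const_iff]
  refine this.congr_fun (fun y hy => ?_) measurableSet_Ioo
  simp [mul_inv_cancel₀ hy.1.ne']

lemma abs_log_le {r : ℝ} (hr : 0 ≤ r) : |Real.log r| ≤ r + r⁻¹ := by
  rcases hr.eq_or_lt with rfl | h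
  · simp
  · have h1 := Real.log_le_sub_one_of_pos h
    have h2 := Real.log_le_sub_one_of_pos (inv_pos.mpr h)
    rw [Real.log_inv] at h2
    have := inv_pos.mpr h
    rw [abs_le]; constructor <;> linarith

lemma li_majorant : LocallyIntegrable (fun x : E2 => (‖x‖ + ‖x‖⁻¹) + (‖x‖ ^ 2 + 1)) volume := by
  have h1 : LocallyIntegrable (fun x : E2 => ‖x‖ + (‖x‖ ^ 2 + 1)) volume :=
    Continuous.locallyIntegrable (by fun_prop)
  refine (h1.add li_inv).congr (Filter.Eventually.of_forall fun x => ?_)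
  simp only [Pi.add_apply]; ring

lemma li_log : LocallyIntegrable (fun x : E2 => Real.log ‖x‖) volume := by
  refine li_majorant.mono (Real.measurable_log.comp measurable_norm).aestronglyMeasurable (Filter.Eventually.of_forall fun x => ?_)
  rw [Real.norm_eq_abs, Real.norm_eq_abs]
  refine (abs_log_le (norm_nonneg x)).trans (le_trans ?_ (le_abs_self _))
  have : 0 ≤ ‖x‖ ^ 2 := by positivity
  linarith

noncomputable def Kk (v x : E2) : ℝ := inner ℝ x v / ‖x‖ ^ 2

lemma Kk_bound (v x : E2) : |Kk v x| ≤ ‖v‖ * ‖x‖⁻¹ := by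
  unfold Kk
  rcases eq_or_ne x 0 with rfl | hx
  · simp
  have h : 0 < ‖x‖ := norm_pos_iff.mpr hx
  rw [abs_div, abs_of_nonneg (sq_nonneg ‖x‖), div_le_iff₀ (by positivity)]
  calc |inner ℝ x v| ≤ ‖x‖ * ‖v‖ := abs_real_inner_le_norm x v
    _ = _ := by field_simp

lemma li_Kk (v : E2) : LocallyIntegrable (Kk v) volume := by
  refine (li_inv.smul ‖v‖).mono ?_ (Filter.Eventually.of_forall fun x => ?_)
  · unfold Kk
    have : Measurable (fun x : E2 => inner ℝ x v / ‖x‖ ^ 2) :=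
      (Measurable.inner measurable_id measurable_const).div (by fun_prop)
    exact this.aestronglyMeasurable
  · refine (Kk_bound v x).trans (le_trans ?_ (le_abs_self _))
    simp

noncomputable def Ge (ε : ℝ) (x : E2) : ℝ := (1/2) * Real.log (‖x‖ ^ 2 + ε)

lemma Ge_contDiff {ε : ℝ} (hε : 0 < ε) : ContDiff ℝ 1 (Ge ε) := by
  unfold Ge
  refine contDiff_const.mul (ContDiff.log ?_ ?_)
  · exact (contDiff_norm_sq ℝ).add contDiff_const
  · intro x; positivity

lemma Ge_fderiv {ε : ℝ} (hε : 0 < ε) (x v : E2) :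
    fderiv ℝ (Ge ε) x v = inner ℝ x v / (‖x‖ ^ 2 + ε) := by
  have h1 : HasFDerivAt (fun x : E2 => ‖x‖ ^ 2 + ε) (2 • (innerSL ℝ x)) x :=
    (hasStrictFDerivAt_norm_sq x).hasFDerivAt.add_const ε
  have h2 := (h1.log (by positivity)).const_mul (1/2 : ℝ)
  have h3 : fderiv ℝ (Ge ε) x = _ := h2.fderiv
  rw [h3]
  simp
  field_simp

lemma Ge_bound {ε : ℝ} (hε : 0 < ε) (h1 : ε ≤ 1) {x : E2} (hx : x ≠ 0) :
    |Ge ε x| ≤ (‖x‖ + ‖x‖⁻¹) + (‖x‖ ^ 2 + 1) := by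
  have h : 0 < ‖x‖ := norm_pos_iff.mpr hx
  have hl := abs_log_le h.le
  have h2 : Real.log (‖x‖ ^ 2) ≤ Real.log (‖x‖ ^ 2 + ε) :=
    Real.log_le_log (by positivity) (by linarith)
  have h3 := Real.log_le_sub_one_of_pos (show 0 < ‖x‖ ^ 2 + ε by positivity)
  rw [Real.log_pow] at h2
  push_cast at h2
  have h4 := abs_le.mp hl
  have h5 : 0 < ‖x‖⁻¹ := inv_pos.mpr h
  unfold Ge
  rw [abs_le]; constructor <;> nlinarith [sq_nonneg ‖x‖]

lemma ne_zero_ae : ∀ᵐ x : E2, x ≠ 0 := by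
  have : ({0}ᶜ : Set E2) ∈ ae (volume : Measure E2) := compl_mem_ae_iff.mpr (by simp)
  exact this

open Filter Topology in
lemma log_ibp {h : E2 → ℝ} (hh : ContDiff ℝ 1 h) (hc : HasCompactSupport h) (x v : E2) :
    cvv (fun x => Real.log ‖x‖) (fun z => fderiv ℝ h z v) x = cvv (Kk v) h x := by
  have hch' : Continuous (fun z => fderiv ℝ h z v) :=
    (hh.continuous_fderiv one_ne_zero).clm_apply continuous_const
  have hc' : HasCompactSupport (fun z => fderiv ℝ h z v) := hc.fderiv_apply ℝ v
  have hε : ∀ n : ℕ, 0 < 1 / ((n : ℝ) + 1) := fun n => by positivity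
  have hε1 : ∀ n : ℕ, 1 / ((n : ℝ) + 1) ≤ 1 := fun n => by
    rw [div_le_one (by positivity)]; have : (0:ℝ) ≤ n := by positivity
    linarith
  have hε0 : Tendsto (fun n : ℕ => 1 / ((n : ℝ) + 1)) atTop (𝓝 0) :=
    tendsto_one_div_add_atTop_nhds_zero_nat
  have T1 : Tendsto (fun n : ℕ => cvv (Ge (1 / ((n : ℝ) + 1))) (fun z => fderiv ℝ h z v) x) atTop
      (𝓝 (cvv (fun x => Real.log ‖x‖) (fun z => fderiv ℝ h z v) x)) := by
    unfold cvv
    refine tendsto_integral_of_dominated_convergence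
      (fun t => ‖((‖t‖ + ‖t‖⁻¹) + (‖t‖ ^ 2 + 1)) * fderiv ℝ h (x - t) v‖) ?_ ?_ ?_ ?_
    · intro n
      exact ((Ge_contDiff (hε n)).continuous.mul (hch'.comp (by fun_prop))).aestronglyMeasurable
    · exact (li_mul_integrable li_majorant hch' hc' x).norm
    · intro n
      filter_upwards [ne_zero_ae] with t ht
      rw [norm_mul, norm_mul]
      refine mul_le_mul_of_nonneg_right ?_ (norm_nonneg _)
      exact (Ge_bound (hε n) (hε1 n) ht).trans (le_abs_self _)
    · filter_upwards [ne_zero_ae] with t ht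
      refine Tendsto.mul_const _ ?_
      unfold Ge
      have h0 : 0 < ‖t‖ := norm_pos_iff.mpr ht
      have : Real.log ‖t‖ = (1/2) * Real.log (‖t‖ ^ 2 + 0) := by
        rw [add_zero, Real.log_pow]; push_cast; ring
      rw [this]
      refine Tendsto.const_mul _ (Tendsto.log (tendsto_const_nhds.add hε0) (by positivity))
  have T2 : Tendsto (fun n : ℕ => cvv (fun z => fderiv ℝ (Ge (1 / ((n : ℝ) + 1))) z v) h x) atTop
      (𝓝 (cvv (Kk v) h x)) := by
    unfold cvv
    refine tendsto_integral_of_dominated_convergence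
      (fun t => ‖(‖t‖⁻¹ * h (x - t))‖ * ‖v‖) ?_ ?_ ?_ ?_
    · intro n
      refine Continuous.aestronglyMeasurable (Continuous.mul ?_ (hh.continuous.comp (by fun_prop)))
      exact ((Ge_contDiff (hε n)).continuous_fderiv one_ne_zero).clm_apply continuous_const
    · exact (li_mul_integrable li_inv hh.continuous hc x).norm.mul_const _
    · intro n
      filter_upwards [ne_zero_ae] with t ht
      have h0 : 0 < ‖t‖ := norm_pos_iff.mpr ht
      rw [norm_mul, norm_mul, Ge_fderiv (hε n)]
      have : ‖inner ℝ t v / (‖t‖ ^ 2 + 1 / ((n : ℝ) + 1))‖ ≤ ‖t‖⁻¹ * ‖v‖ := by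
        have hp := hε n
        rw [norm_div, Real.norm_eq_abs, Real.norm_of_nonneg (by positivity),
          div_le_iff₀ (by positivity)]
        calc |inner ℝ t v| ≤ ‖t‖ * ‖v‖ := abs_real_inner_le_norm t v
          _ = ‖t‖⁻¹ * ‖v‖ * ‖t‖ ^ 2 := by field_simp
          _ ≤ _ := by gcongr; linarith
      calc _ ≤ (‖t‖⁻¹ * ‖v‖) * ‖h (x - t)‖ := by gcongr
        _ = _ := by rw [norm_inv, norm_norm]; ring
    · filter_upwards [ne_zero_ae] with t ht
      refine Tendsto.mul_const _ ?_
      have h0 : 0 < ‖t‖ := norm_pos_iff.mpr ht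
      simp_rw [Ge_fderiv (hε _)]
      unfold Kk
      have : Tendsto (fun n : ℕ => ‖t‖ ^ 2 + 1 / ((n : ℝ) + 1)) atTop (𝓝 (‖t‖ ^ 2)) := by
        simpa using (tendsto_const_nhds (x := ‖t‖ ^ 2)).add hε0
      exact tendsto_const_nhds.div this (by positivity)
  refine tendsto_nhds_unique T1 (T2.congr fun n => ?_)
  exact (cvv_ibp (Ge_contDiff (hε n)) hh hc x v).symm

noncomputable def ee (s : ℝ) : E2 :=
  Complex.orthonormalBasisOneI.repr (Real.cos s + Real.sin s * Complex.I)

lemma ee_cont : Continuous ee := by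
  unfold ee
  fun_prop

lemma ee_norm (s : ℝ) : ‖ee s‖ = 1 := by
  unfold ee
  rw [LinearIsometryEquiv.norm_map]
  simpa using Complex.norm_cos_add_sin_mul_I s

lemma polar_int (f : E2 → ℝ) :
    ∫ x, f x = ∫ p in Set.Ioi (0:ℝ) ×ˢ Set.Ioo (-π) π, p.1 * f (p.1 • ee p.2) := by
  have h1 := (Complex.orthonormalBasisOneI.measurePreserving_repr).integral_comp
    (Complex.orthonormalBasisOneI.repr.toHomeomorph.measurableEmbedding) f
  rw [← h1, ← Complex.integral_comp_polarCoord_symm]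
  rw [polarCoord_target]
  refine setIntegral_congr_fun (measurableSet_Ioi.prod measurableSet_Ioo) fun p _ => ?_
  simp only [smul_eq_mul, Complex.polarCoord_symm_apply]
  unfold ee
  congr 2
  rw [← map_smul, Complex.real_smul]

lemma laplace_ident {h : E2 → ℝ} (hh : ContDiff ℝ 1 h) (hc : HasCompactSupport h) (x : E2) :
    ∫ t, fderiv ℝ h (x - t) t / ‖t‖ ^ 2 = 2 * π * h x := by
  obtain ⟨M, hM⟩ := hc.isCompact.isBounded.subset_closedBall (0 : E2)
  have hz : ∀ z : E2, M < ‖z‖ → z ∉ tsupport h := fun z hz hm => by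
    have := hM hm
    simp at this; linarith
  have hfar : ∀ r s : ℝ, M + ‖x‖ < |r| → M < ‖x - r • ee s‖ := by
    intro r s hr
    have h1 : ‖r • ee s‖ = |r| := by rw [norm_smul, ee_norm]; simp
    have h2 := norm_sub_norm_le (r • ee s) x
    rw [norm_sub_rev] at h2
    linarith
  set k : ℝ × ℝ → ℝ := fun p => fderiv ℝ h (x - p.1 • ee p.2) (ee p.2) with hk
  have hec := ee_cont
  have hkc : Continuous k := by
    refine Continuous.clm_apply ?_ (by fun_prop)
    exact (hh.continuous_fderiv one_ne_zero).comp (by fun_prop)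
  have hk0 : ∀ p : ℝ × ℝ, M + ‖x‖ < |p.1| → k p = 0 := by
    intro p hp
    have : fderiv ℝ h (x - p.1 • ee p.2) = 0 := by
      by_contra hne
      exact hz _ (hfar p.1 p.2 hp) (support_fderiv_subset ℝ hne)
    simp [hk, this]
  rw [polar_int]
  have e1 : ∫ p in Set.Ioi (0:ℝ) ×ˢ Set.Ioo (-π) π,
      p.1 * (fderiv ℝ h (x - p.1 • ee p.2) (p.1 • ee p.2) / ‖p.1 • ee p.2‖ ^ 2) =
      ∫ p in Set.Ioi (0:ℝ) ×ˢ Set.Ioo (-π) π, k p := by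
    refine setIntegral_congr_fun (measurableSet_Ioi.prod measurableSet_Ioo) fun p hp => ?_
    have hp0 : 0 < p.1 := hp.1
    simp only [hk, norm_smul, ee_norm, map_smul, smul_eq_mul, mul_one, Real.norm_eq_abs, sq_abs]
    field_simp
  rw [e1]
  have hint : IntegrableOn k (Set.Ioi (0:ℝ) ×ˢ Set.Ioo (-π) π) volume := by
    have hcomp : IntegrableOn k (Set.Icc (0:ℝ) (M + ‖x‖) ×ˢ Set.Icc (-π) π) volume :=
      hkc.continuousOn.integrableOn_compact (isCompact_Icc.prod isCompact_Icc)
    refine hcomp.of_forall_sdiff_eq_zero (measurableSet_Ioi.prod measurableSet_Ioo) ?_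
    rintro p ⟨hp, hnp⟩
    refine hk0 p ?_
    by_contra hcon
    push Not at hcon
    exact hnp ⟨⟨le_of_lt hp.1, (le_abs_self _).trans hcon⟩, Set.Ioo_subset_Icc_self hp.2⟩
  rw [Measure.volume_eq_prod] at hint ⊢
  rw [IntegrableOn, ← Measure.prod_restrict] at hint
  rw [← Measure.prod_restrict, integral_prod_symm _ hint]
  have inner_int : ∀ s : ℝ, ∫ r in Set.Ioi (0:ℝ), k (r, s) = h x := by
    intro s
    have hcd : ContDiff ℝ 1 (fun r : ℝ => h (x - r • ee s)) := hh.comp (by fun_prop)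
    have hcs : HasCompactSupport (fun r : ℝ => h (x - r • ee s)) := by
      refine HasCompactSupport.intro (isCompact_Icc (a := -(M + ‖x‖)) (b := M + ‖x‖)) ?_
      intro r hr
      have : M + ‖x‖ < |r| := by
        by_contra hcon
        push Not at hcon
        exact hr (abs_le.mp hcon)
      exact image_eq_zero_of_notMem_tsupport (hz _ (hfar r s this))
    have := hcs.integral_Ioi_deriv_eq hcd 0
    have hd : ∀ r, deriv (fun r : ℝ => h (x - r • ee s)) r = - k (r, s) := by
      intro r
      have h1 : HasFDerivAt h (fderiv ℝ h (x - r • ee s)) (x - r • ee s) :=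
        (hh.differentiable one_ne_zero _).hasFDerivAt
      have h2 : HasDerivAt (fun r : ℝ => x - r • ee s) (-(ee s)) r := by
        simpa using ((hasDerivAt_id r).smul_const (ee s)).const_sub x
      have h3 := h1.comp_hasDerivAt r h2
      have h4 : deriv (fun r : ℝ => h (x - r • ee s)) r = _ := h3.deriv
      rw [h4]; simp [hk]
    simp only [hd, integral_neg] at this
    simp at this
    exact this
  simp only [inner_int]
  simp only [integral_const, smul_eq_mul]
  simp [Measure.real, Real.volume_Ioo]
  left
  rw [ENNReal.toReal_ofReal (by positivity)]
  ring



noncomputable def e0 : E2 := EuclideanSpace.single 0 1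
noncomputable def e1 : E2 := EuclideanSpace.single 1 1

lemma e0_norm : ‖e0‖ = 1 := by simp [e0]
lemma e1_norm : ‖e1‖ = 1 := by simp [e1]

lemma e_decomp (t : E2) : t = t 0 • e0 + t 1 • e1 := by
  ext i; fin_cases i <;> simp [e0, e1]

lemma stream_eq (ω : E2 → ℝ) (m R : ℝ) (x : E2) :
    streamR ω m R x = (1 / (2 * π)) * cvv (fun x => Real.log ‖x‖) ω x
      - (m / (2 * π)) * Real.log R := by
  unfold streamR cvv
  congr 2
  rw [← integral_sub_left_eq_self _ volume x]
  simp

lemma stream_props {ω : E2 → ℝ} (hω : ContDiff ℝ 1 ω) (hc : HasCompactSupport ω) (m R : ℝ) :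
    ContDiff ℝ 2 (streamR ω m R) ∧
    (∀ x v, fderiv ℝ (streamR ω m R) x v = (1 / (2 * π)) * cvv (Kk v) ω x) ∧
    (∀ x, fderiv ℝ (fun z => fderiv ℝ (streamR ω m R) z e0) x e0 +
      fderiv ℝ (fun z => fderiv ℝ (streamR ω m R) z e1) x e1 = ω x) := by
  have hs : streamR ω m R = fun x => (1 / (2 * π)) * cvv (fun x => Real.log ‖x‖) ω x
      - (m / (2 * π)) * Real.log R := funext (stream_eq ω m R)
  obtain ⟨a1, a2⟩ := cvv_hasFDerivAt li_log hω hc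
  have b := fun v => cvv_hasFDerivAt (li_Kk v) hω hc
  have hsd : ∀ x v, fderiv ℝ (streamR ω m R) x v = (1 / (2 * π)) * cvv (Kk v) ω x := by
    intro x v
    have hd := ((a1.differentiable one_ne_zero x).hasFDerivAt.const_mul (1 / (2 * π))).sub_const
      ((m / (2 * π)) * Real.log R)
    rw [hs, hd.fderiv]
    simp only [smul_apply, smul_eq_mul]
    rw [a2, log_ibp hω hc]
  have hfun : ∀ v, (fun x => fderiv ℝ (streamR ω m R) x v) =
      fun x => (1 / (2 * π)) * cvv (Kk v) ω x := fun v => funext fun x => hsd x v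
  refine ⟨?_, hsd, ?_⟩
  · refine contDiff_two_of ?_ ?_
    · rw [hs]
      exact ((a1.differentiable one_ne_zero).const_mul _).sub_const _
    · intro v
      rw [hfun]
      exact contDiff_const.mul (b v).1
  · intro x
    have hdd : ∀ v, fderiv ℝ (fun z => fderiv ℝ (streamR ω m R) z v) x v =
        (1 / (2 * π)) * cvv (Kk v) (fun z => fderiv ℝ ω z v) x := by
      intro v
      rw [hfun, ((((b v).1.differentiable one_ne_zero x).hasFDerivAt).const_mul _).fderiv]
      simp only [smul_apply, smul_eq_mul]
      rw [(b v).2]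
    rw [hdd, hdd, ← mul_add]
    have hi : ∀ v, Integrable (fun t => Kk v t * fderiv ℝ ω (x - t) v) volume := fun v =>
      li_mul_integrable (h := fun z => fderiv ℝ ω z v) (li_Kk v)
        ((hω.continuous_fderiv one_ne_zero).clm_apply continuous_const) (hc.fderiv_apply ℝ v) x
    have : cvv (Kk e0) (fun z => fderiv ℝ ω z e0) x + cvv (Kk e1) (fun z => fderiv ℝ ω z e1) x
        = 2 * π * ω x := by
      unfold cvv
      rw [← integral_add (hi e0) (hi e1), ← laplace_ident hω hc x]
      congr 1
      ext t
      have h1 : fderiv ℝ ω (x - t) t =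
          t 0 * fderiv ℝ ω (x - t) e0 + t 1 * fderiv ℝ ω (x - t) e1 := by
        have := congrArg (fderiv ℝ ω (x - t)) (e_decomp t)
        rw [this]
        simp only [map_add, map_smul, smul_eq_mul]
      have k0 : Kk e0 t = t 0 / ‖t‖ ^ 2 := by simp [Kk, e0, EuclideanSpace.inner_single_right]
      have k1 : Kk e1 t = t 1 / ‖t‖ ^ 2 := by simp [Kk, e1, EuclideanSpace.inner_single_right]
      rw [h1, k0, k1]
      ring
    rw [this]
    have := pi_pos
    field_simp

/-- bounds in the layer -/
lemma stream_layer {ω : E2 → ℝ} (hω : ContDiff ℝ 1 ω) (hc : HasCompactSupport ω) {R₀ R d : ℝ}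
    (hR₀ : 0 < R₀) (hR : 4 * R₀ ≤ R)
    (hsupp : Function.support ω ⊆ Metric.closedBall 0 R₀) {x : E2} (hxR : ‖x‖ ≤ R)
    (hd : d ≤ R / 4) (hx : R - ‖x‖ ≤ d) :
    |streamR ω (∫ y, ω y) R x| ≤ (2 * (R₀ + d) / R) * ∫ y, |ω y| ∧
    ∀ v, ‖v‖ = 1 → |fderiv ℝ (streamR ω (∫ y, ω y) R) x v| ≤ (2 / R) * ∫ y, |ω y| := by
  have hωi : Integrable ω volume := hω.continuous.integrable_of_hasCompactSupport hc
  have hRp : 0 < R := by linarith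
  have hI : 0 ≤ ∫ y, |ω y| := integral_nonneg fun y => abs_nonneg _
  have hpi : 1 / (2 * π) ≤ 1 := by
    rw [div_le_one (by positivity)]; linarith [pi_gt_three]
  have hpi0 : 0 < 1 / (2 * π) := by positivity
  have hlow : ∀ y : E2, ‖y‖ ≤ R₀ → R / 2 ≤ ‖x - y‖ := by
    intro y hy
    have := norm_sub_norm_le x y
    linarith
  have hmem : ∀ y : E2, ω y ≠ 0 → ‖y‖ ≤ R₀ := fun y hy => by simpa using hsupp hy
  have hbd : ∀ (k : E2 → ℝ) (c : ℝ), 0 ≤ c → (∀ y, ‖y‖ ≤ R₀ → |k y| ≤ c) →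
      |∫ y, k y * ω y| ≤ c * ∫ y, |ω y| := by
    intro k c hc0 hk
    rw [← integral_const_mul, ← Real.norm_eq_abs]
    refine norm_integral_le_of_norm_le (hωi.abs.const_mul c) (Filter.Eventually.of_forall fun y => ?_)
    rw [norm_mul, Real.norm_eq_abs, Real.norm_eq_abs]
    by_cases h0 : ω y = 0
    · simp [h0]
    · exact mul_le_mul_of_nonneg_right (hk y (hmem y h0)) (abs_nonneg _)
  have hcomm : ∀ k : E2 → ℝ, cvv k ω x = ∫ y, k (x - y) * ω y := by
    intro k
    unfold cvv
    rw [← integral_sub_left_eq_self _ volume x]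
    simp
  constructor
  · have hd0 : 0 ≤ d := by linarith
    have e : streamR ω (∫ y, ω y) R x =
        (1 / (2 * π)) * ∫ y, (Real.log ‖x - y‖ - Real.log R) * ω y := by
      have hi : Integrable (fun y => Real.log ‖x - y‖ * ω y) volume := by
        have := (li_mul_integrable li_log hω.continuous hc x).comp_sub_left x
        simpa using this
      simp_rw [sub_mul]
      rw [integral_sub hi (hωi.const_mul _), integral_const_mul]
      unfold streamR
      ring
    rw [e, abs_mul, abs_of_pos hpi0]
    have := hbd (fun y => Real.log ‖x - y‖ - Real.log R) (2 * (R₀ + d) / R) (by positivity) ?_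
    · calc _ ≤ 1 * |∫ y, (Real.log ‖x - y‖ - Real.log R) * ω y| := by gcongr
        _ ≤ _ := by rw [one_mul]; exact this
    · intro y hy
      have hl := hlow y hy
      have hp : 0 < ‖x - y‖ := by linarith
      have u1 := norm_sub_le x y
      have u2 := norm_sub_norm_le x y
      have l1 := Real.log_le_sub_one_of_pos (div_pos hp hRp)
      have l2 := Real.log_le_sub_one_of_pos (div_pos hRp hp)
      rw [Real.log_div hp.ne' hRp.ne'] at l1
      rw [Real.log_div hRp.ne' hp.ne'] at l2
      have m1 : ‖x - y‖ / R - 1 ≤ 2 * (R₀ + d) / R := by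
        rw [div_sub_one hRp.ne']; gcongr; linarith
      have m2 : R / ‖x - y‖ - 1 ≤ 2 * (R₀ + d) / R := by
        rw [div_sub_one hp.ne', div_le_div_iff₀ hp hRp]
        nlinarith
      rw [abs_le]; constructor <;> linarith
  · intro v hv
    rw [(stream_props hω hc _ R).2.1, abs_mul, abs_of_pos hpi0, hcomm]
    have := hbd (fun y => Kk v (x - y)) (2 / R) (by positivity) ?_
    · calc _ ≤ 1 * |∫ y, Kk v (x - y) * ω y| := by gcongr
        _ ≤ _ := by rw [one_mul]; exact this
    · intro y hy
      refine (Kk_bound v (x - y)).trans ?_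
      rw [hv, one_mul, inv_eq_one_div, div_le_div_iff₀ (by linarith [hlow y hy]) hRp]
      linarith [hlow y hy]



lemma bump_bound {f : ℝ → ℝ} (hf : Continuous f) (h0 : ∀ t < 0, f t = 0) (h1 : ∀ t > 1, f t = 0) :
    ∃ M, 0 ≤ M ∧ ∀ t, |f t| ≤ M := by
  obtain ⟨C, hC⟩ := (isCompact_Icc (a := (0:ℝ)) (b := 1)).exists_bound_of_continuousOn
    hf.continuousOn
  refine ⟨max C 0, le_max_right _ _, fun t => ?_⟩
  by_cases ht0 : t < 0
  · simp [h0 t ht0]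
  by_cases ht1 : t > 1
  · simp [h1 t ht1]
  · exact (hC t ⟨not_lt.mp ht0, not_lt.mp ht1⟩).trans (le_max_left _ _)

lemma deriv_zero_on {f : ℝ → ℝ} {U : Set ℝ} (hU : IsOpen U) {c : ℝ} (h : ∀ t ∈ U, f t = c) :
    ∀ t ∈ U, deriv f t = 0 := by
  intro t ht
  have : f =ᶠ[nhds t] fun _ => c := by
    filter_upwards [hU.mem_nhds ht] with s hs using h s hs
  rw [this.deriv_eq]; simp

lemma norm_hasFDerivAt {x : E2} (hx : x ≠ 0) :
    HasFDerivAt (fun z : E2 => ‖z‖) (‖x‖⁻¹ • innerSL ℝ x) x := by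
  have h : 0 < ‖x‖ := norm_pos_iff.mpr hx
  have h1 := ((hasStrictFDerivAt_norm_sq x).hasFDerivAt).sqrt (by positivity)
  have h2 : (fun z : E2 => √(‖z‖ ^ 2)) = fun z => ‖z‖ := by
    ext z; exact Real.sqrt_sq (norm_nonneg z)
  rw [h2, Real.sqrt_sq h.le] at h1
  convert! h1 using 1
  ext v
  simp
  field_simp

lemma cutoff_near {δ₁ θ R : ℝ} {g : ℝ → ℝ} 
    (hg1 : ∀ t, δ₁ / 2 ≤ t → g t = 1) {x : E2} (hx : δ₁ / 2 < R ^ (-θ) * (R - ‖x‖)) :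
    cutoff g θ R =ᶠ[nhds x] fun _ => 1 := by
  have : IsOpen {z : E2 | δ₁ / 2 < R ^ (-θ) * (R - ‖z‖)} := isOpen_lt (by fun_prop) (by fun_prop)
  filter_upwards [this.mem_nhds hx] with z hz
  exact hg1 _ (le_of_lt hz)

lemma rpow_facts {θ R : ℝ} (hθ : θ ∈ Set.Icc (0:ℝ) 1) (hR : 1 ≤ R) :
    0 < R ^ (-θ) ∧ R ^ (-θ) ≤ 1 ∧ R ^ (-θ) * R ^ θ = 1 ∧ R ^ θ ≤ R ∧ 1 ≤ R ^ θ := by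
  have h0 : 0 < R := by linarith
  refine ⟨by positivity, Real.rpow_le_one_of_one_le_of_nonpos hR (by linarith [hθ.1]), ?_, ?_,
    Real.one_le_rpow hR hθ.1⟩
  · rw [← Real.rpow_add h0]; simp
  · calc R ^ θ ≤ R ^ (1:ℝ) := Real.rpow_le_rpow_of_exponent_le hR hθ.2
      _ = R := Real.rpow_one R

lemma layer_of_not {δ₁ θ R : ℝ} (hθ : θ ∈ Set.Icc (0:ℝ) 1) (hδ : δ₁ ≤ 1/2) (hR : 1 ≤ R) {x : E2}
    (hx : R ^ (-θ) * (R - ‖x‖) ≤ δ₁ / 2) : R - ‖x‖ ≤ R ^ θ / 4 ∧ 3 / 4 * R ≤ ‖x‖ := by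
  obtain ⟨h1, h2, h3, h4, h5⟩ := rpow_facts hθ hR
  have : R - ‖x‖ ≤ R ^ θ / 4 := by
    have e : R - ‖x‖ = R ^ θ * (R ^ (-θ) * (R - ‖x‖)) := by
      rw [← mul_assoc, mul_comm (R ^ θ), h3, one_mul]
    rw [e]
    nlinarith
  exact ⟨this, by linarith⟩

lemma cutoff_contDiff {δ₁ θ R : ℝ} (hθ : θ ∈ Set.Icc (0:ℝ) 1) (hδ : δ₁ ≤ 1/2) (hR : 1 ≤ R)
    {g : ℝ → ℝ} (hg : ContDiff ℝ (⊤ : ℕ∞) g)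
    (hg1 : ∀ t, δ₁ / 2 ≤ t → g t = 1) : ContDiff ℝ 2 (cutoff g θ R) := by
  rw [contDiff_iff_contDiffAt]
  intro x
  by_cases hx : δ₁ / 2 < R ^ (-θ) * (R - ‖x‖)
  · exact contDiffAt_const.congr_of_eventuallyEq (cutoff_near hg1 hx)
  · have hl := layer_of_not hθ hδ hR (not_lt.mp hx)
    have hx0 : x ≠ 0 := by
      rintro rfl; simp at hl; linarith
    unfold cutoff
    have hg2 : ContDiff ℝ 2 g := contDiff_infty.mp hg 2
    exact hg2.contDiffAt.comp x (contDiffAt_const.mul (contDiffAt_const.sub (contDiffAt_norm ℝ hx0)))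

lemma cutoff_fderiv {θ R : ℝ} {g : ℝ → ℝ} (hg : Differentiable ℝ g) {x : E2} (hx : x ≠ 0) (v : E2) :
    fderiv ℝ (cutoff g θ R) x v =
      -(R ^ (-θ)) * (deriv g (R ^ (-θ) * (R - ‖x‖)) * (inner ℝ x v * ‖x‖⁻¹)) := by
  have h1 := ((norm_hasFDerivAt hx).const_sub R).const_mul (R ^ (-θ))
  have h2 := (hg (R ^ (-θ) * (R - ‖x‖))).hasDerivAt.comp_hasFDerivAt x h1
  have h3 : fderiv ℝ (cutoff g θ R) x = _ := h2.fderiv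
  rw [h3]
  simp
  ring

lemma cutoff_fderiv2 {θ R : ℝ} {g : ℝ → ℝ} (hg : Differentiable ℝ g)
    (hg' : Differentiable ℝ (deriv g)) {x : E2} (hx : x ≠ 0) (v : E2) :
    fderiv ℝ (fun z => fderiv ℝ (cutoff g θ R) z v) x v =
      -(R ^ (-θ)) * (deriv g (R ^ (-θ) * (R - ‖x‖)) *
        (inner ℝ v v * ‖x‖⁻¹ - (inner ℝ x v) ^ 2 * ‖x‖⁻¹ ^ 3)
        - R ^ (-θ) * deriv (deriv g) (R ^ (-θ) * (R - ‖x‖)) * (inner ℝ x v * ‖x‖⁻¹) ^ 2) := by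
  have hx' : 0 < ‖x‖ := norm_pos_iff.mpr hx
  have hev : (fun z => fderiv ℝ (cutoff g θ R) z v) =ᶠ[nhds x] fun z =>
      -(R ^ (-θ)) * (deriv g (R ^ (-θ) * (R - ‖z‖)) * (inner ℝ z v * ‖z‖⁻¹)) := by
    filter_upwards [isOpen_ne.mem_nhds hx] with z hz using cutoff_fderiv hg hz v
  rw [hev.fderiv_eq]
  have hN := norm_hasFDerivAt hx
  have h1 := (hN.const_sub R).const_mul (R ^ (-θ))
  have h2 :=
    (hg' (R ^ (-θ) * (R - ‖x‖))).hasDerivAt.comp_hasFDerivAt x h1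
  have h3 : HasFDerivAt (fun z : E2 => (inner ℝ z v : ℝ)) (innerSL ℝ v) x := by
    have := (innerSL ℝ v).hasFDerivAt (x := x)
    refine this.congr_of_eventuallyEq (Filter.Eventually.of_forall fun z => ?_)
    simp [real_inner_comm]
  have h4 :=
    (hasDerivAt_inv hx'.ne').comp_hasFDerivAt x hN
  have h5 := (h2.mul (h3.mul h4)).const_mul (-(R ^ (-θ)))
  have h6 : fderiv ℝ (fun z =>
      -(R ^ (-θ)) * (deriv g (R ^ (-θ) * (R - ‖z‖)) * (inner ℝ z v * ‖z‖⁻¹))) x = _ := h5.fderiv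
  rw [h6]
  simp [-inner_self_eq_norm_sq_to_K, real_inner_comm v x]
  field_simp
  ring

lemma cutoff_bounds {δ₁ θ : ℝ} (hθ : θ ∈ Set.Icc (0:ℝ) 1) (hδ : δ₁ ≤ 1/2)
    {g : ℝ → ℝ} (hg : ContDiff ℝ (⊤ : ℕ∞) g)
    (hg0 : ∀ t ≤ (0:ℝ), g t = 0)
    (hg1 : ∀ t, δ₁ / 2 ≤ t → g t = 1) :
    ∃ M, 0 ≤ M ∧ ∀ R, 1 ≤ R → ∀ x : E2, 
      (∀ v, fderiv ℝ (cutoff g θ R) x v = 0 ∧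
        fderiv ℝ (fun z => fderiv ℝ (cutoff g θ R) z v) x v = 0) ∨
      (R - ‖x‖ ≤ R ^ θ / 4 ∧ ∀ v, ‖v‖ = 1 → |fderiv ℝ (cutoff g θ R) x v| ≤ M * R ^ (-θ) ∧
        |fderiv ℝ (fun z => fderiv ℝ (cutoff g θ R) z v) x v| ≤ M * (R ^ (-θ)) ^ 2) := by
  have hg2 : ContDiff ℝ 2 g := contDiff_infty.mp hg 2
  have hgd : Differentiable ℝ g := hg2.differentiable (by norm_num)
  have hg1' : ContDiff ℝ 1 (deriv g) := by
    have : ContDiff ℝ (1 + 1) g := by simpa [one_add_one_eq_two] using hg2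
    exact (contDiff_succ_iff_deriv.mp this).2.2
  have hgd' : Differentiable ℝ (deriv g) := hg1'.differentiable one_ne_zero
  have z0 : ∀ t ∈ Set.Iio (0:ℝ), deriv g t = 0 :=
    deriv_zero_on isOpen_Iio (fun t ht => hg0 t (le_of_lt ht))
  have z1 : ∀ t ∈ Set.Ioi (1:ℝ), deriv g t = 0 :=
    deriv_zero_on isOpen_Ioi (c := 1) (fun t ht => hg1 t (by have : 1 < t := ht; linarith))
  obtain ⟨M1, hM1, hb1⟩ := bump_bound hg1'.continuous z0 z1
  obtain ⟨M2, hM2, hb2⟩ := bump_bound (hg1'.continuous_deriv (by norm_num))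
    (deriv_zero_on isOpen_Iio z0) (deriv_zero_on isOpen_Ioi z1)
  refine ⟨M2 + 3 * M1, by positivity, fun R hR x => ?_⟩
  by_cases hx : δ₁ / 2 < R ^ (-θ) * (R - ‖x‖)
  · left
    intro v
    have hn := cutoff_near hg1 hx
    have hn' := hn.fderiv (𝕜 := ℝ)
    refine ⟨by rw [hn.fderiv_eq]; simp, ?_⟩
    have : (fun z => fderiv ℝ (cutoff g θ R) z v) =ᶠ[nhds x] fun _ => 0 := by
      filter_upwards [hn'] with z hz
      rw [hz]; simp
    rw [this.fderiv_eq]; simp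
  · right
    have hl := layer_of_not hθ hδ hR (not_lt.mp hx)
    obtain ⟨a1, a2, a3, a4, a5⟩ := rpow_facts hθ hR
    have hx' : 0 < ‖x‖ := by linarith
    have hx0 : x ≠ 0 := norm_pos_iff.mp hx'
    refine ⟨hl.1, fun v hv => ?_⟩
    have hinn : |inner ℝ x v * ‖x‖⁻¹| ≤ 1 := by
      have := abs_real_inner_le_norm x v
      rw [hv, mul_one] at this
      rw [abs_mul, abs_inv, abs_norm, ← div_eq_mul_inv, div_le_one hx']
      exact this
    set a := R ^ (-θ)
    set q := inner ℝ x v * ‖x‖⁻¹ with hq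
    have hb1' := hb1 (a * (R - ‖x‖))
    have hb2' := hb2 (a * (R - ‖x‖))
    set G1 := deriv g (a * (R - ‖x‖))
    set G2 := deriv (deriv g) (a * (R - ‖x‖))
    have hinv : ‖x‖⁻¹ ≤ 4 / 3 * a := by
      have : 1 ≤ 4 / 3 * a * ‖x‖ := by nlinarith
      rw [inv_le_iff_one_le_mul₀ hx']; exact this
    have hinv0 : 0 < ‖x‖⁻¹ := inv_pos.mpr hx'
    have hqs : q ^ 2 ≤ 1 := (sq_le_one_iff_abs_le_one q).mpr hinn
    constructor
    · rw [cutoff_fderiv hgd hx0, abs_mul, abs_neg, abs_of_pos a1, abs_mul]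
      calc a * (|G1| * |q|) ≤ a * (M1 * 1) := by gcongr
        _ ≤ _ := by nlinarith
    · rw [cutoff_fderiv2 hgd hgd' hx0]
      have e : (inner ℝ v v * ‖x‖⁻¹ - (inner ℝ x v) ^ 2 * ‖x‖⁻¹ ^ 3) = ‖x‖⁻¹ * (1 - q ^ 2) := by
        rw [hq, real_inner_self_eq_norm_sq, hv]; ring
      rw [e, abs_mul, abs_neg, abs_of_pos a1]
      have t1 : |G1 * (‖x‖⁻¹ * (1 - q ^ 2))| ≤ M1 * (4 / 3 * a * 1) := by
        rw [abs_mul, abs_mul, abs_of_pos hinv0, abs_of_nonneg (by linarith : 0 ≤ 1 - q ^ 2)]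
        gcongr
        linarith [sq_nonneg q]
      have t2 : |a * G2 * q ^ 2| ≤ a * M2 * 1 := by
        rw [abs_mul, abs_mul, abs_of_pos a1, abs_of_nonneg (sq_nonneg q)]
        gcongr
      calc _ ≤ a * (|G1 * (‖x‖⁻¹ * (1 - q ^ 2))| + |a * G2 * q ^ 2|) := by
            gcongr; exact abs_sub _ _
        _ ≤ a * (M1 * (4 / 3 * a * 1) + a * M2 * 1) := by gcongr
        _ ≤ _ := by nlinarith [mul_nonneg hM1 (sq_nonneg a)]



lemma dir_contDiff {F : E2 → ℝ} (hF : ContDiff ℝ 2 F) (v : E2) :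
    ContDiff ℝ 1 (fun z => fderiv ℝ F z v) :=
  (hF.fderiv_right (m := 1) (by norm_num)).clm_apply contDiff_const

lemma dir_symm {F : E2 → ℝ} (hF : ContDiff ℝ 2 F) (x v w : E2) :
    fderiv ℝ (fun z => fderiv ℝ F z v) x w = fderiv ℝ (fun z => fderiv ℝ F z w) x v := by
  have hs : IsSymmSndFDerivAt ℝ F x := hF.contDiffAt.isSymmSndFDerivAt (by simp)
  have hd : DifferentiableAt ℝ (fderiv ℝ F) x :=
    (hF.fderiv_right (m := 1) (by norm_num)).differentiable one_ne_zero x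
  rw [fderiv_clm_apply hd (by fun_prop), fderiv_clm_apply hd (by fun_prop)]
  simpa using hs w v

noncomputable def HS (F : E2 → ℝ) (x : E2) : ℝ :=
  (fderiv ℝ (fun z => fderiv ℝ F z e0) x e0) ^ 2 + (fderiv ℝ (fun z => fderiv ℝ F z e0) x e1) ^ 2 +
  (fderiv ℝ (fun z => fderiv ℝ F z e1) x e0) ^ 2 + (fderiv ℝ (fun z => fderiv ℝ F z e1) x e1) ^ 2

noncomputable def Lap (F : E2 → ℝ) (x : E2) : ℝ :=
  fderiv ℝ (fun z => fderiv ℝ F z e0) x e0 + fderiv ℝ (fun z => fderiv ℝ F z e1) x e1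

lemma dd_cont {F : E2 → ℝ} (hF : ContDiff ℝ 2 F) (v w : E2) :
    Continuous (fun x => fderiv ℝ (fun z => fderiv ℝ F z v) x w) :=
  ((dir_contDiff hF v).continuous_fderiv one_ne_zero).clm_apply continuous_const

lemma dd_cs {F : E2 → ℝ} (hc : HasCompactSupport F) (v w : E2) :
    HasCompactSupport (fun x => fderiv ℝ (fun z => fderiv ℝ F z v) x w) :=
  (hc.fderiv_apply ℝ v).fderiv_apply ℝ w

lemma hess_int {F : E2 → ℝ} (hF : ContDiff ℝ 2 F) (hc : HasCompactSupport F) :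
    ∫ x, HS F x = ∫ x, (Lap F x) ^ 2 := by
  have hsw := swap_deriv (dir_contDiff hF e0) (hc.fderiv_apply ℝ e0) (dir_contDiff hF e1)
    (hc.fderiv_apply ℝ e1) e0 e1
  have hi : ∀ v w v' w', Integrable (fun x => fderiv ℝ (fun z => fderiv ℝ F z v) x w *
      fderiv ℝ (fun z => fderiv ℝ F z v') x w') volume := fun v w v' w' =>
    ((dd_cont hF v w).mul (dd_cont hF v' w')).integrable_of_hasCompactSupport
      ((dd_cs hc v w).mul_right)
  have hLi : Integrable (fun x => (Lap F x) ^ 2) volume := by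
    refine Continuous.integrable_of_hasCompactSupport ?_ ?_
    · unfold Lap
      exact ((dd_cont hF e0 e0).add (dd_cont hF e1 e1)).pow 2
    · have : HasCompactSupport (Lap F) := (dd_cs hc e0 e0).add (dd_cs hc e1 e1)
      exact this.comp_left (g := fun y : ℝ => y ^ 2) (by simp)
  have e : ∀ x, HS F x = (Lap F x) ^ 2 + ((2 * (fderiv ℝ (fun z => fderiv ℝ F z e0) x e1 *
      fderiv ℝ (fun z => fderiv ℝ F z e1) x e0)) - 2 * (fderiv ℝ (fun z => fderiv ℝ F z e0) x e0 *
      fderiv ℝ (fun z => fderiv ℝ F z e1) x e1)) := by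
    intro x
    unfold HS Lap
    rw [dir_symm hF x e1 e0]; ring
  simp_rw [e]
  have j1 := (hi e0 e1 e1 e0).const_mul 2
  have j2 := (hi e0 e0 e1 e1).const_mul 2
  have j3 := integral_sub j1 j2
  rw [integral_const_mul, integral_const_mul, hsw, sub_self] at j3
  have j4 := integral_add hLi (j1.sub j2)
  simp only [Pi.sub_apply] at j4
  rw [j4, j3, add_zero]

lemma HS_nonneg (F : E2 → ℝ) (x : E2) : 0 ≤ HS F x := by unfold HS; positivity

lemma opnorm_le {F : E2 → ℝ} (hF : ContDiff ℝ 2 F) (x : E2) :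
    ‖fderiv ℝ (perpGrad F) x‖ ≤ √(HS F x) := by
  have hd : ∀ v, DifferentiableAt ℝ (fun z => fderiv ℝ F z v) x := fun v =>
    (dir_contDiff hF v).differentiable one_ne_zero x
  have hc0 : ∀ z, perpGrad F z 0 = - fderiv ℝ F z e1 := fun z => by simp [perpGrad, e1]
  have hc1 : ∀ z, perpGrad F z 1 = fderiv ℝ F z e0 := fun z => by simp [perpGrad, e0]
  have hdiff : DifferentiableAt ℝ (perpGrad F) x := by
    rw [differentiableAt_euclidean]
    intro i
    fin_cases i
    · exact (funext hc0 : (fun z => perpGrad F z 0) = _) ▸ (hd e1).neg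
    · exact (funext hc1 : (fun z => perpGrad F z 1) = _) ▸ (hd e0)
  have hcomp : ∀ i v, (fderiv ℝ (perpGrad F) x v) i = fderiv ℝ (fun z => perpGrad F z i) x v := by
    intro i v
    have h1 := ((EuclideanSpace.proj i : E2 →L[ℝ] ℝ).hasFDerivAt).comp x hdiff.hasFDerivAt
    have h2 : fderiv ℝ (fun z => perpGrad F z i) x = _ := h1.fderiv
    rw [h2]; simp
  refine ContinuousLinearMap.opNorm_le_bound _ (Real.sqrt_nonneg _) fun v => ?_
  have hv : ∀ f : E2 →L[ℝ] ℝ, f v = v 0 * f e0 + v 1 * f e1 := by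
    intro f
    have := congrArg f (e_decomp v)
    rw [this]; simp only [map_add, map_smul, smul_eq_mul]
  have n1 : ‖v‖ ^ 2 = v 0 ^ 2 + v 1 ^ 2 := by
    rw [EuclideanSpace.norm_sq_eq]; simp
  have n2 : ‖fderiv ℝ (perpGrad F) x v‖ ^ 2 = (fderiv ℝ (fun z => fderiv ℝ F z e1) x v) ^ 2 +
      (fderiv ℝ (fun z => fderiv ℝ F z e0) x v) ^ 2 := by
    rw [EuclideanSpace.norm_sq_eq]
    simp only [Fin.sum_univ_two, hcomp, hc0, hc1, Real.norm_eq_abs, sq_abs]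
    congr 1
    have : fderiv ℝ (fun z => -fderiv ℝ F z e1) x = - fderiv ℝ (fun z => fderiv ℝ F z e1) x :=
      fderiv_fun_neg
    rw [this]; simp
  refine abs_le_of_sq_le_sq' ?_ (by positivity) |>.2
  rw [mul_pow, Real.sq_sqrt (HS_nonneg F x), n1, n2, hv, hv]
  unfold HS
  generalize fderiv ℝ (fun z => fderiv ℝ F z e0) x e0 = a
  generalize fderiv ℝ (fun z => fderiv ℝ F z e0) x e1 = b
  generalize fderiv ℝ (fun z => fderiv ℝ F z e1) x e0 = c
  generalize fderiv ℝ (fun z => fderiv ℝ F z e1) x e1 = d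
  generalize v 0 = p
  generalize v 1 = q
  nlinarith [sq_nonneg (p * b - q * a), sq_nonneg (p * d - q * c)]

lemma eLp_bound {F : E2 → ℝ} (hF : ContDiff ℝ 2 F) (hc : HasCompactSupport F) (s : Set E2) :
    eLpNorm (fun x => fderiv ℝ (perpGrad F) x) 2 (volume.restrict s) ≤
      ENNReal.ofReal (√(∫ x, (Lap F x) ^ 2)) := by
  have hcont : Continuous (fun x => √(HS F x)) := by
    have h00 := dd_cont hF e0 e0
    have h01 := dd_cont hF e0 e1
    have h10 := dd_cont hF e1 e0
    have h11 := dd_cont hF e1 e1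
    unfold HS
    exact ((((h00.pow 2).add (h01.pow 2)).add (h10.pow 2)).add (h11.pow 2)).sqrt
  have hcs : HasCompactSupport (fun x => √(HS F x)) := by
    have hsq : ∀ v w, HasCompactSupport (fun x => (fderiv ℝ (fun z => fderiv ℝ F z v) x w) ^ 2) :=
      fun v w => (dd_cs hc v w).comp_left (g := fun y : ℝ => y ^ 2) (by simp)
    have hH : HasCompactSupport (HS F) :=
      (((hsq e0 e0).add (hsq e0 e1)).add (hsq e1 e0)).add (hsq e1 e1)
    exact hH.comp_left (g := Real.sqrt) Real.sqrt_zero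
  have hm : MemLp (fun x => √(HS F x)) 2 volume := hcont.memLp_of_hasCompactSupport hcs
  calc _ ≤ eLpNorm (fun x => fderiv ℝ (perpGrad F) x) 2 volume :=
        eLpNorm_mono_measure _ Measure.restrict_le_self
    _ ≤ eLpNorm (fun x => √(HS F x)) 2 volume := eLpNorm_mono_real (opnorm_le hF)
    _ = _ := by
      rw [hm.eLpNorm_eq_integral_rpow_norm (by norm_num) (by norm_num), ← hess_int hF hc,
        Real.sqrt_eq_rpow]
      congr 2
      · refine integral_congr_ae (Filter.Eventually.of_forall fun x => ?_)
        simp [Real.sq_sqrt (HS_nonneg F x)]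
      · simp

lemma lap_mul {f h : E2 → ℝ} (hf : ContDiff ℝ 2 f) (hh : ContDiff ℝ 2 h) (x : E2) :
    Lap (fun x => f x * h x) x = f x * Lap h x +
      2 * (fderiv ℝ f x e0 * fderiv ℝ h x e0 + fderiv ℝ f x e1 * fderiv ℝ h x e1) +
      h x * Lap f x := by
  have hfd := hf.differentiable (by norm_num)
  have hhd := hh.differentiable (by norm_num)
  have h1 : ∀ v, (fun z => fderiv ℝ (fun x => f x * h x) z v) =
      fun z => f z * fderiv ℝ h z v + h z * fderiv ℝ f z v := by
    intro v; ext z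
    rw [fderiv_fun_mul (hfd z) (hhd z)]; simp
  have h2 : ∀ v, fderiv ℝ (fun z => fderiv ℝ (fun x => f x * h x) z v) x v =
      f x * fderiv ℝ (fun z => fderiv ℝ h z v) x v + 2 * (fderiv ℝ f x v * fderiv ℝ h x v) +
      h x * fderiv ℝ (fun z => fderiv ℝ f z v) x v := by
    intro v
    have d1 := (dir_contDiff hf v).differentiable one_ne_zero x
    have d2 := (dir_contDiff hh v).differentiable one_ne_zero x
    rw [h1, fderiv_fun_add ((hfd x).fun_mul d2) ((hhd x).fun_mul d1), fderiv_fun_mul (hfd x) d2,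
      fderiv_fun_mul (hhd x) d1]
    simp
    ring
  unfold Lap
  rw [h2, h2]; ring

lemma cs_fin {Ω : Type*} [MeasurableSpace Ω] (μ : Measure Ω) [IsFiniteMeasure μ] {f : Ω → ℝ}
    (hV : 0 < μ.real Set.univ) (i1 : Integrable f μ) (i2 : Integrable (fun y => (f y) ^ 2) μ) :
    (∫ y, f y ∂μ) ^ 2 ≤ μ.real Set.univ * ∫ y, (f y) ^ 2 ∂μ := by
  have hex : ∀ V I : ℝ, 0 ≤ V ^ 2 * (∫ y, (f y) ^ 2 ∂μ) - 2 * V * I * (∫ y, f y ∂μ) +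
        μ.real Set.univ * I ^ 2 := by
    intro V I
    have h1 : ∫ y, (V ^ 2 * (f y) ^ 2 - 2 * V * I * f y + I ^ 2) ∂μ =
        V ^ 2 * (∫ y, (f y) ^ 2 ∂μ) - 2 * V * I * (∫ y, f y ∂μ) + μ.real Set.univ * I ^ 2 := by
      have q := integral_add ((i2.const_mul (V ^ 2)).sub (i1.const_mul (2 * V * I)))
        (integrable_const (I ^ 2))
      simp only [Pi.sub_apply] at q
      rw [q, integral_sub (i2.const_mul (V ^ 2)) (i1.const_mul (2 * V * I)),
        integral_const_mul, integral_const_mul, integral_const, smul_eq_mul]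
    rw [← h1]
    refine integral_nonneg fun y => ?_
    have : V ^ 2 * (f y) ^ 2 - 2 * V * I * f y + I ^ 2 = (V * f y - I) ^ 2 := by ring
    simp only [Pi.zero_apply]
    rw [this]
    positivity
  have h := hex (μ.real Set.univ) (∫ y, f y ∂μ)
  have h2 : 0 ≤ μ.real Set.univ * (μ.real Set.univ * (∫ y, (f y) ^ 2 ∂μ) - (∫ y, f y ∂μ) ^ 2) := by
    linarith [h]
  have := nonneg_of_mul_nonneg_right h2 hV
  linarith

lemma ball_vol_pos {R₀ : ℝ} (hR₀ : 0 < R₀) :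
    0 < volume.real (Metric.closedBall (0 : E2) R₀) :=
  ENNReal.toReal_pos (Metric.measure_closedBall_pos volume (0 : E2) hR₀).ne'
    (isCompact_closedBall (0 : E2) R₀).measure_lt_top.ne

lemma sq_int {ω : E2 → ℝ} (hω : Continuous ω) (hc : HasCompactSupport ω) :
    Integrable (fun y => (ω y) ^ 2) volume := by
  have h : HasCompactSupport (fun y => (ω y) ^ 2) := by
    refine hc.mono fun y hy => ?_
    rw [Function.mem_support] at hy ⊢
    intro h
    exact hy (by rw [h]; exact zero_pow two_ne_zero)
  have h2 : Continuous (fun y => (ω y) ^ 2) := by fun_prop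
  exact h2.integrable_of_hasCompactSupport h

lemma abs_int {ω : E2 → ℝ} (hω : Continuous ω) (hc : HasCompactSupport ω) :
    Integrable (fun y => |ω y|) volume :=
  (hω.integrable_of_hasCompactSupport hc).norm

lemma L1_L2 {ω : E2 → ℝ} (hω : Continuous ω) {R₀ : ℝ} (hR₀ : 0 < R₀)
    (hsupp : Function.support ω ⊆ Metric.closedBall 0 R₀) (hc : HasCompactSupport ω) :
    (∫ y, |ω y|) ^ 2 ≤ volume.real (Metric.closedBall (0 : E2) R₀) * ∫ y, (ω y) ^ 2 := by
  have i1 := abs_int hω hc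
  have i2 := sq_int hω hc
  have i3 : Integrable (fun y => |ω y| ^ 2) volume := by simpa only [sq_abs] using i2
  have h0 : ∀ y, y ∉ Metric.closedBall (0 : E2) R₀ → ω y = 0 := fun y hy => by
    by_contra h; exact hy (hsupp h)
  have s1 : ∫ y in Metric.closedBall (0 : E2) R₀, |ω y| = ∫ y, |ω y| :=
    setIntegral_eq_integral_of_forall_compl_eq_zero fun y hy => by rw [h0 y hy, abs_zero]
  have s2 : ∫ y in Metric.closedBall (0 : E2) R₀, |ω y| ^ 2 = ∫ y, (ω y) ^ 2 := by
    simp only [sq_abs]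
    exact setIntegral_eq_integral_of_forall_compl_eq_zero fun y hy => by
      rw [h0 y hy]; exact zero_pow two_ne_zero
  have hu : (volume.restrict (Metric.closedBall (0 : E2) R₀)).real Set.univ =
      volume.real (Metric.closedBall (0 : E2) R₀) := by
    rw [Measure.real, Measure.restrict_apply_univ, Measure.real]
  have : IsFiniteMeasure (volume.restrict (Metric.closedBall (0 : E2) R₀)) :=
    ⟨by rw [Measure.restrict_apply_univ]; exact (isCompact_closedBall (0 : E2) R₀).measure_lt_top⟩
  have h := cs_fin (volume.restrict (Metric.closedBall (0 : E2) R₀)) (f := fun y => |ω y|)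
    (by rw [hu]; exact ball_vol_pos hR₀) i1.restrict i3.restrict
  rw [hu, s1, s2] at h
  exact h


lemma pt_alg {M a b R R₀ I W G d0 d1 p0 p1 S Q0 Q1 : ℝ} (hM : 0 ≤ M) (ha : 0 < a) (ha1 : a ≤ 1)
    (hab : a * b = 1) (hb : 1 ≤ b) (hR : 1 ≤ R) (hR₀ : 0 < R₀) (hI : 0 ≤ I) (hG : |G| ≤ 1)
    (h0 : |d0| ≤ M * a) (h1 : |d1| ≤ M * a) (hp0 : |p0| ≤ 2 / R * I) (hp1 : |p1| ≤ 2 / R * I)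
    (hS : |S| ≤ (2 * (R₀ + b / 4) / R) * I) (hQ0 : |Q0| ≤ M * a ^ 2) (hQ1 : |Q1| ≤ M * a ^ 2) :
    |G * W + 2 * (d0 * p0 + d1 * p1) + S * (Q0 + Q1)| ≤
      |W| + ((8 * M + 4 * M * (R₀ + 1)) / R) * I := by
  have hR' : 0 < R := by linarith
  have t1 : |G * W| ≤ |W| := by
    rw [abs_mul]; nlinarith [abs_nonneg W]
  have hMa : M * a ≤ M := by nlinarith
  have key : ∀ d p : ℝ, |d| ≤ M * a → |p| ≤ 2 / R * I → |d * p| ≤ M * (2 / R * I) := by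
    intro d p hd hp
    rw [abs_mul]
    exact mul_le_mul (hd.trans hMa) hp (abs_nonneg _) hM
  have t2 := key _ _ h0 hp0
  have t3 := key _ _ h1 hp1
  have t4 : |S * (Q0 + Q1)| ≤ (4 * M * (R₀ + 1) / R) * I := by
    rw [abs_mul]
    have hq : |Q0 + Q1| ≤ 2 * (M * a ^ 2) := (abs_add_le _ _).trans (by linarith)
    have : |S| * |Q0 + Q1| ≤ ((2 * (R₀ + b / 4) / R) * I) * (2 * (M * a ^ 2)) :=
      mul_le_mul hS hq (abs_nonneg _) (by positivity)
    refine this.trans ?_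
    have e : ((2 * (R₀ + b / 4) / R) * I) * (2 * (M * a ^ 2)) =
        (4 * M * (R₀ * a ^ 2 + a * (a * b) / 4) / R) * I := by ring
    rw [e, hab]
    have ha2 : a ^ 2 ≤ 1 := pow_le_one₀ ha.le ha1
    have : R₀ * a ^ 2 + a * 1 / 4 ≤ R₀ + 1 := by nlinarith [mul_le_mul_of_nonneg_left ha2 hR₀.le]
    gcongr
  have := abs_add_le (G * W + 2 * (d0 * p0 + d1 * p1)) (S * (Q0 + Q1))
  have h5 := abs_add_le (G * W) (2 * (d0 * p0 + d1 * p1))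
  have h6 : |2 * (d0 * p0 + d1 * p1)| = 2 * |d0 * p0 + d1 * p1| := by
    rw [abs_mul]; norm_num
  have h7 := abs_add_le (d0 * p0) (d1 * p1)
  have e2 : ((8 * M + 4 * M * (R₀ + 1)) / R) * I =
    4 * (M * (2 / R * I)) + (4 * M * (R₀ + 1) / R) * I := by ring
  rw [e2]
  linarith

lemma vol_R {R : ℝ} (hR : 0 ≤ R) : volume.real (Metric.closedBall (0 : E2) R) =
    R ^ 2 * volume.real (Metric.ball (0 : E2) 1) := by
  rw [Measure.real, Measure.addHaar_closedBall volume (0 : E2) hR, ENNReal.toReal_mul,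
    ENNReal.toReal_ofReal (by positivity), Measure.real]
  simp

lemma int_bound {L ω : E2 → ℝ} {R c : ℝ} (hL : Continuous L) (hLc : HasCompactSupport L)
    (hω : Continuous ω) (hc : HasCompactSupport ω)
    (h0 : ∀ x, x ∉ Metric.closedBall (0 : E2) R → L x = 0)
    (h1 : ∀ x ∈ Metric.closedBall (0 : E2) R, |L x| ≤ |ω x| + c) (hcn : 0 ≤ c) :
    ∫ x, (L x) ^ 2 ≤ 2 * (∫ x, (ω x) ^ 2) + 2 * c ^ 2 * volume.real (Metric.closedBall (0 : E2) R) := by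
  have i1 := sq_int hL hLc
  have i2 := sq_int hω hc
  have hms : MeasurableSet (Metric.closedBall (0 : E2) R) := Metric.isClosed_closedBall.measurableSet
  have i3 : Integrable ((Metric.closedBall (0 : E2) R).indicator fun _ => 2 * c ^ 2) volume :=
    (integrable_indicator_iff hms).2
      (integrableOn_const (isCompact_closedBall (0 : E2) R).measure_lt_top.ne)
  have hle : ∀ x, (L x) ^ 2 ≤
      2 * (ω x) ^ 2 + (Metric.closedBall (0 : E2) R).indicator (fun _ => 2 * c ^ 2) x := by
    intro x
    by_cases hx : x ∈ Metric.closedBall (0 : E2) R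
    · rw [Set.indicator_of_mem hx, ← sq_abs (L x), ← sq_abs (ω x)]
      have := h1 x hx
      nlinarith [abs_nonneg (L x), abs_nonneg (ω x), sq_nonneg (|ω x| - c)]
    · rw [Set.indicator_of_notMem hx, h0 x hx]
      nlinarith [sq_nonneg (ω x)]
  have := integral_mono i1 ((i2.const_mul 2).add i3) hle
  simp only [Pi.add_apply] at this
  rw [integral_add (i2.const_mul 2) i3, integral_const_mul, integral_indicator hms,
    setIntegral_const, smul_eq_mul] at this
  linarith

theorem truncation_gradient_L2_bound (R₀ θ δ₁ : ℝ) (hR₀ : 0 < R₀)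
    (hθ : θ ∈ Set.Icc (0:ℝ) 1) (hδ₁ : δ₁ ∈ Set.Ioc (0:ℝ) (1/2))
    (g : ℝ → ℝ) (hg : ContDiff ℝ (⊤ : ℕ∞) g)
    (hg01 : ∀ t, g t ∈ Set.Icc (0:ℝ) 1)
    (hg0 : ∀ t ≤ (0:ℝ), g t = 0)
    (hg1 : ∀ t, δ₁ / 2 ≤ t → g t = 1) :
    ∃ C > 0, ∀ ω : EuclideanSpace ℝ (Fin 2) → ℝ,
      ContDiff ℝ 1 ω →
      Function.support ω ⊆ Metric.closedBall 0 R₀ →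
      ∀ R : ℝ, max (4 * R₀) 1 ≤ R →
        eLpNorm
            (fun x => fderiv ℝ (truncate g θ R ω (∫ y, ω y)) x) 2
            (volume.restrict (Metric.ball 0 R)) ≤
          ENNReal.ofReal (C * Real.sqrt (∫ y, (ω y) ^ 2)) := by
  obtain ⟨M, hM, hcb⟩ := cutoff_bounds hθ hδ₁.2 hg hg0 hg1
  obtain ⟨C', hC'⟩ : ∃ C', C' = 8 * M + 4 * M * (R₀ + 1) := ⟨_, rfl⟩
  have hC'0 : 0 ≤ C' := by rw [hC']; positivity
  obtain ⟨V0, hV0⟩ : ∃ V, V = volume.real (Metric.closedBall (0 : E2) R₀) := ⟨_, rfl⟩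
  obtain ⟨V1, hV1⟩ : ∃ V, V = volume.real (Metric.ball (0 : E2) 1) := ⟨_, rfl⟩
  have hV0n : 0 ≤ V0 := by rw [hV0]; exact measureReal_nonneg
  have hV1n : 0 ≤ V1 := by rw [hV1]; exact measureReal_nonneg
  refine ⟨√(2 + 2 * C' ^ 2 * V1 * V0), Real.sqrt_pos.2 (by positivity), ?_⟩
  intro ω hω hsupp R hRm
  have hR4 : 4 * R₀ ≤ R := (le_max_left _ _).trans hRm
  have hR1 : 1 ≤ R := (le_max_right _ _).trans hRm
  have hR : 0 < R := by linarith
  have hc : HasCompactSupport ω :=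
    HasCompactSupport.intro (isCompact_closedBall (0 : E2) R₀) fun y hy => by
      by_contra h; exact hy (hsupp h)
  obtain ⟨hs2, -, hsl⟩ := stream_props hω hc (∫ y, ω y) R
  have hcd := cutoff_contDiff hθ hδ₁.2 hR1 hg hg1
  obtain ⟨ha, ha1, hab, hbR, hb1⟩ := rpow_facts hθ hR1
  have hF : ContDiff ℝ 2 (fun x => cutoff g θ R x * streamR ω (∫ y, ω y) R x) := hcd.mul hs2
  have hz : ∀ x : E2, x ∉ Metric.closedBall (0 : E2) R →
      cutoff g θ R x * streamR ω (∫ y, ω y) R x = 0 := by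
    intro x hx
    rw [mem_closedBall_zero_iff, not_le] at hx
    have : cutoff g θ R x = 0 := hg0 _ (mul_nonpos_of_nonneg_of_nonpos ha.le (by linarith))
    rw [this, zero_mul]
  have hFc : HasCompactSupport (fun x => cutoff g θ R x * streamR ω (∫ y, ω y) R x) :=
    HasCompactSupport.intro (isCompact_closedBall (0 : E2) R) hz
  refine (eLp_bound hF hFc _).trans (ENNReal.ofReal_le_ofReal ?_)
  rw [← Real.sqrt_mul (by positivity)]
  refine Real.sqrt_le_sqrt ?_
  have hI : 0 ≤ ∫ y, |ω y| := integral_nonneg fun y => abs_nonneg _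
  have hLc : HasCompactSupport (Lap (fun x => cutoff g θ R x * streamR ω (∫ y, ω y) R x)) :=
    (dd_cs hFc e0 e0).add (dd_cs hFc e1 e1)
  have hLcont : Continuous (Lap (fun x => cutoff g θ R x * streamR ω (∫ y, ω y) R x)) :=
    (dd_cont hF e0 e0).add (dd_cont hF e1 e1)
  have hlz : ∀ x, x ∉ Metric.closedBall (0 : E2) R →
      Lap (fun x => cutoff g θ R x * streamR ω (∫ y, ω y) R x) x = 0 := by
    intro x hx
    have hev : ∀ y ∈ (Metric.closedBall (0 : E2) R)ᶜ, ∀ v : E2,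
        fderiv ℝ (fun x => cutoff g θ R x * streamR ω (∫ y, ω y) R x) y v = 0 := by
      intro y hy v
      have : (fun x => cutoff g θ R x * streamR ω (∫ y, ω y) R x) =ᶠ[nhds y] fun _ => 0 := by
        filter_upwards [Metric.isClosed_closedBall.isOpen_compl.mem_nhds hy] with z hz'
        exact hz z hz'
      rw [this.fderiv_eq]; simp
    have hev2 : ∀ v : E2, fderiv ℝ (fun z => fderiv ℝ
        (fun x => cutoff g θ R x * streamR ω (∫ y, ω y) R x) z v) x v = 0 := by
      intro v
      have : (fun z => fderiv ℝ (fun x => cutoff g θ R x * streamR ω (∫ y, ω y) R x) z v)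
          =ᶠ[nhds x] fun _ => 0 := by
        filter_upwards [Metric.isClosed_closedBall.isOpen_compl.mem_nhds hx] with z hz'
        exact hev z hz' v
      rw [this.fderiv_eq]; simp
    unfold Lap
    rw [hev2, hev2, add_zero]
  have hpt : ∀ x ∈ Metric.closedBall (0 : E2) R,
      |Lap (fun x => cutoff g θ R x * streamR ω (∫ y, ω y) R x) x| ≤
        |ω x| + (C' / R) * ∫ y, |ω y| := by
    intro x hx
    rw [mem_closedBall_zero_iff] at hx
    rw [lap_mul hcd hs2 x]
    have hl : Lap (streamR ω (∫ y, ω y) R) x = ω x := hsl x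
    rw [hl]
    have hG : |cutoff g θ R x| ≤ 1 := by
      unfold cutoff
      rw [abs_of_nonneg (hg01 _).1]; exact (hg01 _).2
    have hlc : Lap (cutoff g θ R) x = fderiv ℝ (fun z => fderiv ℝ (cutoff g θ R) z e0) x e0 +
      fderiv ℝ (fun z => fderiv ℝ (cutoff g θ R) z e1) x e1 := rfl
    rw [hlc]
    rcases hcb R hR1 x with h | ⟨hlay, h⟩
    · rw [(h e0).1, (h e1).1, (h e0).2, (h e1).2]
      simp only [zero_mul, add_zero, mul_zero]
      rw [abs_mul]
      have : 0 ≤ (C' / R) * ∫ y, |ω y| := by positivity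
      nlinarith [abs_nonneg (ω x)]
    · obtain ⟨q0, q1⟩ := stream_layer hω hc hR₀ hR4 hsupp hx (by linarith : R ^ θ / 4 ≤ R / 4) hlay
      rw [hC']
      exact pt_alg hM ha ha1 hab hb1 hR1 hR₀ hI hG (h e0 e0_norm).1 (h e1 e1_norm).1
        (q1 e0 e0_norm) (q1 e1 e1_norm) q0 (h e0 e0_norm).2 (h e1 e1_norm).2
  have hb := int_bound hLcont hLc hω.continuous hc hlz hpt (by positivity)
  have hL := L1_L2 hω.continuous hR₀ hsupp hc
  rw [vol_R hR.le, ← hV1] at hb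
  rw [← hV0] at hL
  refine hb.trans ?_
  have e : 2 * (C' / R * ∫ y, |ω y|) ^ 2 * (R ^ 2 * V1) =
      2 * C' ^ 2 * V1 * (∫ y, |ω y|) ^ 2 := by
    field_simp
  rw [e]
  have : 2 * C' ^ 2 * V1 * (∫ y, |ω y|) ^ 2 ≤ 2 * C' ^ 2 * V1 * (V0 * ∫ y, (ω y) ^ 2) := by
    gcongr
  refine (add_le_add_right this _).trans (le_of_eq ?_)
  ring
end

section
/- Let R₀ > 0, θ ∈ [0,1], δ₁ ∈ (0,1/2]. Let ω : ℝ² → ℝ be continuous with support contained in B(0,R₀), set m = ∫_{ℝ²} ω, and let u(x) = (1/(2π)) ∫_{ℝ²} ((x−y)^⊥/|x−y|²) ω(y) dy. For R > 0 let A_R = { x ∈ ℝ² : R − δ₁R^θ ≤ |x| ≤ R } be the boundary annulus of the disk B(0,R). Then there exists a constant C > 0, depending only on R₀ and δ₁, such that for every R ≥ max(4R₀, 1): ‖u‖_{L²(A_R)} ≤ C ( ‖ω‖_{L¹(ℝ²)} R^{(θ−3)/2} + |m| R^{(θ−1)/2} ). -/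
open MeasureTheory Real

theorem perp_norm (z : EuclideanSpace ℝ (Fin 2)) : ‖perp z‖ = ‖z‖ := by
  simp [perp, EuclideanSpace.norm_eq, Fin.sum_univ_two, add_comm]

theorem perp_smul' (c : ℝ) (z : EuclideanSpace ℝ (Fin 2)) : perp (c • z) = c • perp z := by
  ext i; fin_cases i <;> simp [perp]

theorem perp_sub' (z w : EuclideanSpace ℝ (Fin 2)) : perp (z - w) = perp z - perp w := by
  ext i; fin_cases i <;> simp [perp] <;> ring

theorem perp_cont : Continuous perp := by
  unfold perp
  refine (EuclideanSpace.equiv (Fin 2) ℝ).symm.continuous.comp ?_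
  refine continuous_pi fun i => ?_
  fin_cases i <;> simp <;> fun_prop

theorem kernel_diff (x z : EuclideanSpace ℝ (Fin 2)) (hx : x ≠ 0) (hz : z ≠ 0) :
    ‖(1 / ‖z‖ ^ 2) • perp z - (1 / ‖x‖ ^ 2) • perp x‖ = ‖z - x‖ / (‖z‖ * ‖x‖) := by
  rw [← perp_smul', ← perp_smul', ← perp_sub', perp_norm]
  have := dist_div_norm_sq_smul hz hx 1
  simp only [dist_eq_norm, div_pow, one_pow] at this
  rw [this]; ring

theorem bs_bound (R₀ R : ℝ) (hR₀ : 0 < R₀) (hR : 4 * R₀ ≤ R)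
    (ω : EuclideanSpace ℝ (Fin 2) → ℝ) (hc : Continuous ω)
    (hs : Function.support ω ⊆ Metric.closedBall 0 R₀)
    (x : EuclideanSpace ℝ (Fin 2)) (hx : R / 2 ≤ ‖x‖) :
    ‖biotSavart2D ω x‖ ≤ 2 * R₀ / R ^ 2 * (∫ y, |ω y|) + |∫ y, ω y| / R := by
  have hRp : 0 < R := by linarith
  have hcs : HasCompactSupport ω :=
    HasCompactSupport.of_support_subset_isCompact (isCompact_closedBall 0 R₀) hs
  have hi : Integrable ω := hc.integrable_of_hasCompactSupport hcs
  have hia : Integrable (fun y => |ω y|) := hi.abs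
  have hx0 : x ≠ 0 := by
    rintro rfl; simp at hx; linarith
  have hfar : ∀ y, ω y ≠ 0 → ‖y‖ ≤ R₀ ∧ R / 4 ≤ ‖x - y‖ := by
    intro y hy
    have h1 : ‖y‖ ≤ R₀ := by simpa using hs hy
    have h2 := norm_sub_norm_le x y
    exact ⟨h1, by linarith⟩
  have hdiff : ∀ y, ‖(ω y / ‖x - y‖ ^ 2) • perp (x - y) - ω y • ((1 / ‖x‖ ^ 2) • perp x)‖
      ≤ 8 * R₀ / R ^ 2 * |ω y| := by
    intro y
    by_cases hy : ω y = 0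
    · simp [hy]
    obtain ⟨h1, h2⟩ := hfar y hy
    have hz : x - y ≠ 0 := by
      intro h; rw [h] at h2; simp at h2; linarith
    have e : (ω y / ‖x - y‖ ^ 2) • perp (x - y) - ω y • ((1 / ‖x‖ ^ 2) • perp x)
        = ω y • ((1 / ‖x - y‖ ^ 2) • perp (x - y) - (1 / ‖x‖ ^ 2) • perp x) := by
      rw [smul_sub, smul_smul (ω y) (1 / ‖x - y‖ ^ 2)]; simp [div_eq_mul_inv]
    rw [e, norm_smul, kernel_diff _ _ hx0 hz, mul_comm, Real.norm_eq_abs]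
    refine mul_le_mul_of_nonneg_right ?_ (abs_nonneg _)
    have : x - y - x = -y := by abel
    rw [this, norm_neg]
    calc ‖y‖ / (‖x - y‖ * ‖x‖) ≤ R₀ / (R / 4 * (R / 2)) := by gcongr
      _ = 8 * R₀ / R ^ 2 := by field_simp; norm_num
  have hg : Integrable (fun y => ω y • ((1 / ‖x‖ ^ 2) • perp x)) := hi.smul_const _
  have hd : Integrable (fun y => (ω y / ‖x - y‖ ^ 2) • perp (x - y)
      - ω y • ((1 / ‖x‖ ^ 2) • perp x)) := by
    refine Integrable.mono' (hia.const_mul (8 * R₀ / R ^ 2)) ?_ (Filter.Eventually.of_forall hdiff)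
    apply Measurable.aestronglyMeasurable
    have := hc.measurable
    have := perp_cont.measurable
    fun_prop
  have hsplit : ∫ y, (ω y / ‖x - y‖ ^ 2) • perp (x - y)
      = (∫ y, ((ω y / ‖x - y‖ ^ 2) • perp (x - y) - ω y • ((1 / ‖x‖ ^ 2) • perp x)))
        + (∫ y, ω y) • ((1 / ‖x‖ ^ 2) • perp x) := by
    rw [← integral_smul_const, ← integral_add hd hg]
    simp
  have hb1 : ‖∫ y, ((ω y / ‖x - y‖ ^ 2) • perp (x - y) - ω y • ((1 / ‖x‖ ^ 2) • perp x))‖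
      ≤ 8 * R₀ / R ^ 2 * (∫ y, |ω y|) := by
    rw [← integral_const_mul]
    exact norm_integral_le_of_norm_le (hia.const_mul _) (Filter.Eventually.of_forall hdiff)
  have hb2 : ‖(∫ y, ω y) • ((1 / ‖x‖ ^ 2) • perp x)‖ ≤ |∫ y, ω y| * (2 / R) := by
    rw [norm_smul, norm_smul, perp_norm, Real.norm_eq_abs]
    gcongr
    have hxp : 0 < ‖x‖ := norm_pos_iff.mpr hx0
    have : ‖(1 / ‖x‖ ^ 2 : ℝ)‖ * ‖x‖ = 1 / ‖x‖ := by
      rw [Real.norm_of_nonneg (by positivity)]; field_simp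
    rw [this]
    calc 1 / ‖x‖ ≤ 1 / (R / 2) := by gcongr
      _ = 2 / R := by field_simp
  unfold biotSavart2D
  rw [norm_smul, hsplit]
  have hpi : ‖(1 / (2 * π) : ℝ)‖ ≤ 1 / 4 := by
    rw [Real.norm_of_nonneg (by positivity)]
    apply one_div_le_one_div_of_le (by norm_num)
    linarith [Real.pi_gt_three]
  have hIa : 0 ≤ ∫ y, |ω y| := integral_nonneg fun _ => abs_nonneg _
  calc _ ≤ 1 / 4 * (8 * R₀ / R ^ 2 * (∫ y, |ω y|) + |∫ y, ω y| * (2 / R)) := by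
        gcongr
        exact (norm_add_le _ _).trans (add_le_add hb1 hb2)
    _ ≤ _ := by
        have : 0 ≤ |∫ y, ω y| / R := by positivity
        have e : 1 / 4 * (8 * R₀ / R ^ 2 * (∫ y, |ω y|) + |∫ y, ω y| * (2 / R))
          = 2 * R₀ / R ^ 2 * (∫ y, |ω y|) + |∫ y, ω y| / R / 2 := by ring
        rw [e]; linarith

theorem annulus_vol (a R : ℝ) (ha : 0 ≤ a) (hR : a ≤ R) :
    volume {x : EuclideanSpace ℝ (Fin 2) | a ≤ ‖x‖ ∧ ‖x‖ ≤ R}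
      ≤ ENNReal.ofReal (π * (R ^ 2 - a ^ 2)) := by
  have e : {x : EuclideanSpace ℝ (Fin 2) | a ≤ ‖x‖ ∧ ‖x‖ ≤ R}
      = Metric.closedBall 0 R \ Metric.ball 0 a := by
    ext x; simp [and_comm]
  rw [e, measure_sdiff ((Metric.ball_subset_ball hR).trans Metric.ball_subset_closedBall)
    Metric.isOpen_ball.measurableSet.nullMeasurableSet measure_ball_lt_top.ne,
    EuclideanSpace.volume_ball_fin_two, EuclideanSpace.volume_closedBall_fin_two,
    ← ENNReal.ofReal_pow ha, ← ENNReal.ofReal_pow (ha.trans hR),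
    ← ENNReal.ofReal_mul (by positivity), ← ENNReal.ofReal_mul (by positivity),
    ← ENNReal.ofReal_sub _ (by positivity)]
  apply ENNReal.ofReal_le_ofReal
  apply le_of_eq; ring

theorem velocity_L2_annulus (R₀ δ₁ : ℝ) (hR₀ : 0 < R₀)
    (hδ₁ : δ₁ ∈ Set.Ioc (0:ℝ) (1/2)) :
    ∃ C > 0, ∀ θ : ℝ, θ ∈ Set.Icc (0:ℝ) 1 →
      ∀ ω : EuclideanSpace ℝ (Fin 2) → ℝ,
      Continuous ω →
      Function.support ω ⊆ Metric.closedBall 0 R₀ →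
      ∀ R : ℝ, max (4 * R₀) 1 ≤ R →
        eLpNorm (biotSavart2D ω) 2
            (volume.restrict
              {x : EuclideanSpace ℝ (Fin 2) | R - δ₁ * R ^ θ ≤ ‖x‖ ∧ ‖x‖ ≤ R}) ≤
          ENNReal.ofReal (C * ((∫ y, |ω y|) * R ^ ((θ - 3) / 2) +
            |∫ y, ω y| * R ^ ((θ - 1) / 2))) := by
  obtain ⟨hd0, hd1⟩ := hδ₁
  refine ⟨2 * (2 * R₀ + 1), by positivity, ?_⟩
  rintro θ ⟨hθ0, hθ1⟩ ω hc hs R hR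
  have hR4 : 4 * R₀ ≤ R := (le_max_left _ _).trans hR
  have hR1 : 1 ≤ R := (le_max_right _ _).trans hR
  have hRp : 0 < R := by linarith
  have hRθ : R ^ θ ≤ R := by
    simpa using Real.rpow_le_rpow_of_exponent_le hR1 hθ1
  have hRθp : 0 < R ^ θ := Real.rpow_pos_of_pos hRp θ
  have hw : δ₁ * R ^ θ ≤ R / 2 := by nlinarith
  have hw0 : 0 < δ₁ * R ^ θ := by positivity
  have hIa : 0 ≤ ∫ y, |ω y| := integral_nonneg fun _ => abs_nonneg _
  set A := {x : EuclideanSpace ℝ (Fin 2) | R - δ₁ * R ^ θ ≤ ‖x‖ ∧ ‖x‖ ≤ R} with hA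
  have hAm : MeasurableSet A :=
    ((isClosed_le continuous_const continuous_norm).inter
      (isClosed_le continuous_norm continuous_const)).measurableSet
  set B := 2 * R₀ / R ^ 2 * (∫ y, |ω y|) + |∫ y, ω y| / R with hB
  have hB0 : 0 ≤ B := by positivity
  have hbd : ∀ᵐ x ∂(volume.restrict A), ‖biotSavart2D ω x‖ ≤ B := by
    refine (ae_restrict_iff' hAm).mpr (Filter.Eventually.of_forall fun x hx => ?_)
    exact bs_bound R₀ R hR₀ hR4 ω hc hs x (by have := hx.1; linarith)
  have hvol : volume A ≤ ENNReal.ofReal ((2 * R ^ ((1 + θ) / 2)) ^ 2) := by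
    refine (annulus_vol _ R (by linarith) (by linarith)).trans (ENNReal.ofReal_le_ofReal ?_)
    have e : (R ^ ((1 + θ) / 2)) ^ 2 = R * R ^ θ := by
      rw [← Real.rpow_natCast, ← Real.rpow_mul hRp.le]
      have : (1 + θ) / 2 * ((2 : ℕ) : ℝ) = 1 + θ := by push_cast; ring
      rw [this, Real.rpow_add hRp, Real.rpow_one]
    rw [mul_pow, e]
    have h4 := Real.pi_le_four
    have h0 := Real.pi_pos
    have h5 : R ^ 2 - (R - δ₁ * R ^ θ) ^ 2 ≤ R * R ^ θ := by
      nlinarith [mul_pos hRp hRθp]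
    calc _ ≤ π * (R * R ^ θ) := by gcongr
      _ ≤ 2 ^ 2 * (R * R ^ θ) := by gcongr; linarith
  have key := eLpNorm_le_of_ae_bound (p := 2) hbd
  refine key.trans ?_
  rw [Measure.restrict_apply_univ]
  have hvs : volume A ^ (ENNReal.toReal 2)⁻¹ ≤ ENNReal.ofReal (2 * R ^ ((1 + θ) / 2)) := by
    calc _ ≤ (ENNReal.ofReal ((2 * R ^ ((1 + θ) / 2)) ^ 2)) ^ (ENNReal.toReal 2)⁻¹ := by gcongr
      _ = _ := by
        rw [ENNReal.ofReal_rpow_of_nonneg (by positivity) (by positivity)]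
        congr 1
        rw [← Real.rpow_natCast, ← Real.rpow_mul (by positivity)]
        simp
  calc _ ≤ ENNReal.ofReal (2 * R ^ ((1 + θ) / 2)) * ENNReal.ofReal B := by gcongr
    _ = ENNReal.ofReal (2 * R ^ ((1 + θ) / 2) * B) := by
        rw [← ENNReal.ofReal_mul (by positivity)]
    _ ≤ _ := by
      apply ENNReal.ofReal_le_ofReal
      have e1 : R ^ ((θ - 3) / 2) = R ^ ((1 + θ) / 2) / R ^ 2 := by
        rw [← Real.rpow_natCast R 2, ← Real.rpow_sub hRp]; congr 1; push_cast; ring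
      have e2 : R ^ ((θ - 1) / 2) = R ^ ((1 + θ) / 2) / R := by
        rw [← Real.rpow_sub_one hRp.ne']; congr 1; ring
      rw [e1, e2, hB]
      have hP : 0 < R ^ ((1 + θ) / 2) := Real.rpow_pos_of_pos hRp _
      set P := R ^ ((1 + θ) / 2)
      set I := ∫ y, |ω y|
      set M := |∫ y, ω y|
      have hM : 0 ≤ M := abs_nonneg _
      have t1 : 0 ≤ 2 * (I * (P / R ^ 2)) := by positivity
      have t2 : 0 ≤ 4 * R₀ * (M * (P / R)) := by positivity
      have e : 2 * (2 * R₀ + 1) * (I * (P / R ^ 2) + M * (P / R))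
        = 2 * P * (2 * R₀ / R ^ 2 * I + M / R) + 2 * (I * (P / R ^ 2))
          + 4 * R₀ * (M * (P / R)) := by ring
      rw [e]; linarith
end

section
/- Let R₀ > 0 and K > 0. Let ω : ℝ³ → ℝ³ be a continuous vector field with support contained in the closed ball B(0,R₀). Define Ψ(x) = (1/(4π)) ∫_{ℝ³} ω(y)/|x−y| dy and u = curl Ψ. For each R > 0 let φ_R : ℝ³ → ℝ be a smooth function with 0 ≤ φ_R ≤ 1, φ_R(x) = 1 for |x| ≤ R/2, φ_R(x) = 0 for |x| ≥ R, and sup_x ‖Dφ_R(x)‖ ≤ K/R. Then there exists a constant C > 0, depending only on R₀ and K, such that for every R ≥ 8R₀: ‖u − curl(φ_R Ψ)‖_{L²(B(0,R))} ≤ C ‖ω‖_{L²(ℝ³)} R^{−1/2}. -/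
open MeasureTheory Real

/-- The curl of a vector field on `ℝ³`, computed via the Fréchet derivative. -/
noncomputable def curl3 (F : EuclideanSpace ℝ (Fin 3) → EuclideanSpace ℝ (Fin 3))
    (x : EuclideanSpace ℝ (Fin 3)) : EuclideanSpace ℝ (Fin 3) :=
  (EuclideanSpace.equiv (Fin 3) ℝ).symm
    ![fderiv ℝ F x (EuclideanSpace.single 1 1) 2 -
        fderiv ℝ F x (EuclideanSpace.single 2 1) 1,
      fderiv ℝ F x (EuclideanSpace.single 2 1) 0 -
        fderiv ℝ F x (EuclideanSpace.single 0 1) 2,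
      fderiv ℝ F x (EuclideanSpace.single 0 1) 1 -
        fderiv ℝ F x (EuclideanSpace.single 1 1) 0]

/-- The componentwise Newtonian potential (vector-valued stream function)
`Ψ(x) = (1/(4π)) ∫ ω(y)/|x−y| dy` of a vector field `ω` on `ℝ³`. -/
noncomputable def vectorStream (ω : EuclideanSpace ℝ (Fin 3) → EuclideanSpace ℝ (Fin 3))
    (x : EuclideanSpace ℝ (Fin 3)) : EuclideanSpace ℝ (Fin 3) :=
  (1 / (4 * π)) • ∫ y, (1 / ‖x - y‖) • ω y

lemma aux_curl (F G : EuclideanSpace ℝ (Fin 3) → EuclideanSpace ℝ (Fin 3))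
    (x : EuclideanSpace ℝ (Fin 3)) :
    ‖curl3 F x - curl3 G x‖ ≤ 4 * ‖fderiv ℝ F x - fderiv ℝ G x‖ := by
  set D := fderiv ℝ F x - fderiv ℝ G x with hD
  have key : ∀ i j : Fin 3, |D (EuclideanSpace.single i 1) j| ≤ ‖D‖ := by
    intro i j
    calc |D (EuclideanSpace.single i 1) j| ≤ ‖D (EuclideanSpace.single i 1)‖ := by
          rw [← Real.norm_eq_abs]; exact PiLp.norm_apply_le _ _
      _ ≤ ‖D‖ * ‖(EuclideanSpace.single i 1 : EuclideanSpace ℝ (Fin 3))‖ := D.le_opNorm _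
      _ = ‖D‖ := by simp
  have hval : ∀ i j : Fin 3, D (EuclideanSpace.single i 1) j =
      fderiv ℝ F x (EuclideanSpace.single i 1) j - fderiv ℝ G x (EuclideanSpace.single i 1) j := by
    intro i j; simp [hD]
  have two : ∀ i j k l : Fin 3,
      (D (EuclideanSpace.single i 1) j - D (EuclideanSpace.single k 1) l) ^ 2 ≤ 4 * ‖D‖ ^ 2 := by
    intro i j k l
    have h1 := abs_le.1 (key i j)
    have h2 := abs_le.1 (key k l)
    nlinarith [norm_nonneg D]
  rw [EuclideanSpace.norm_eq]
  apply Real.sqrt_le_iff.2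
  refine ⟨by positivity, ?_⟩
  simp only [Real.norm_eq_abs, sq_abs, Fin.sum_univ_three]
  have e0 : (curl3 F x - curl3 G x) 0 =
      D (EuclideanSpace.single 1 1) 2 - D (EuclideanSpace.single 2 1) 1 := by
    rw [hval, hval]; simp [curl3]; ring
  have e1 : (curl3 F x - curl3 G x) 1 =
      D (EuclideanSpace.single 2 1) 0 - D (EuclideanSpace.single 0 1) 2 := by
    rw [hval, hval]; simp [curl3]; ring
  have e2 : (curl3 F x - curl3 G x) 2 =
      D (EuclideanSpace.single 0 1) 1 - D (EuclideanSpace.single 1 1) 0 := by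
    rw [hval, hval]; simp [curl3]; ring
  rw [e0, e1, e2]
  nlinarith [two 1 2 2 1, two 2 0 0 2, two 0 1 1 0, sq_nonneg ‖D‖]

/-- derivative of `1/‖z‖` -/
noncomputable def auxA (z : EuclideanSpace ℝ (Fin 3)) : EuclideanSpace ℝ (Fin 3) →L[ℝ] ℝ :=
  (-(‖z‖ ^ 2)⁻¹) • fderiv ℝ (fun w : EuclideanSpace ℝ (Fin 3) => ‖w‖) z

lemma auxA_meas : Measurable auxA := by
  unfold auxA
  have := measurable_fderiv ℝ (fun w : EuclideanSpace ℝ (Fin 3) => ‖w‖)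
  have h2 : Measurable (fun z : EuclideanSpace ℝ (Fin 3) => -(‖z‖ ^ 2)⁻¹) := by fun_prop
  exact h2.smul this

lemma auxA_norm (z : EuclideanSpace ℝ (Fin 3)) : ‖auxA z‖ ≤ (‖z‖ ^ 2)⁻¹ := by
  unfold auxA
  rw [norm_smul, norm_neg, Real.norm_of_nonneg (by positivity)]
  have : ‖fderiv ℝ (fun w : EuclideanSpace ℝ (Fin 3) => ‖w‖) z‖ ≤ 1 := by
    have := norm_fderiv_le_of_lipschitz ℝ (x₀ := z)
      (lipschitzWith_one_norm (E := EuclideanSpace ℝ (Fin 3)))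
    simpa using this
  exact mul_le_of_le_one_right (by positivity) this

lemma auxA_deriv (z : EuclideanSpace ℝ (Fin 3)) (hz : z ≠ 0) :
    HasFDerivAt (fun w : EuclideanSpace ℝ (Fin 3) => 1 / ‖w‖) (auxA z) z := by
  have h : HasFDerivAt (fun w : EuclideanSpace ℝ (Fin 3) => ‖w‖)
      (fderiv ℝ (fun w : EuclideanSpace ℝ (Fin 3) => ‖w‖) z) z :=
    ((contDiffAt_norm ℝ (n := 1) hz).differentiableAt (by norm_num)).hasFDerivAt
  have h1 := (hasDerivAt_inv (norm_ne_zero_iff.2 hz)).comp_hasFDerivAt z h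
  simpa [auxA, one_div, Function.comp_def] using h1

lemma aux_diff (x y v : EuclideanSpace ℝ (Fin 3)) (h : v ≠ 0 → x - y ≠ 0) :
    HasFDerivAt (fun x : EuclideanSpace ℝ (Fin 3) => (1 / ‖x - y‖) • v)
      ((auxA (x - y)).smulRight v) x := by
  by_cases hv : v = 0
  · have h0 : (auxA (x - y)).smulRight v = 0 := by ext; simp [hv]
    rw [h0]
    simp only [hv, smul_zero]
    exact hasFDerivAt_const _ _
  have h1 : HasFDerivAt (fun x : EuclideanSpace ℝ (Fin 3) => 1 / ‖x - y‖) (auxA (x - y)) x := by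
    have := (auxA_deriv (x - y) (h hv)).comp x ((hasFDerivAt_id x).sub_const y)
    rwa [ContinuousLinearMap.comp_id] at this
  exact h1.smul_const v

lemma aux_meas {α E F : Type*} [MeasurableSpace α] [NormedAddCommGroup E] [NormedSpace ℝ E]
    [NormedAddCommGroup F] [NormedSpace ℝ F] (μ : Measure α) (g : α → E →L[ℝ] ℝ) (w : α → F)
    (hg : AEStronglyMeasurable g μ) (hw : AEStronglyMeasurable w μ) :
    AEStronglyMeasurable (fun y => (g y).smulRight (w y)) μ := by
  have hc : Continuous (fun p : (E →L[ℝ] ℝ) × F => p.1.smulRight p.2) :=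
    isBoundedBilinearMap_smulRight.continuous
  exact hc.comp_aestronglyMeasurable (hg.prodMk hw)

lemma aux_int (R₀ : ℝ)
    (ω : EuclideanSpace ℝ (Fin 3) → EuclideanSpace ℝ (Fin 3)) (hω : Continuous ω)
    (hs : Function.support ω ⊆ Metric.closedBall 0 R₀) : Integrable ω ∧ HasCompactSupport ω := by
  have : HasCompactSupport ω := HasCompactSupport.intro (isCompact_closedBall 0 R₀)
    (fun x hx => by by_contra h; exact hx (hs h))
  exact ⟨hω.integrable_of_hasCompactSupport this, this⟩

lemma aux_pot (R₀ R : ℝ) (hR₀ : 0 < R₀) (hR : 8 * R₀ ≤ R)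
    (ω : EuclideanSpace ℝ (Fin 3) → EuclideanSpace ℝ (Fin 3)) (hω : Continuous ω)
    (hs : Function.support ω ⊆ Metric.closedBall 0 R₀)
    (x₀ : EuclideanSpace ℝ (Fin 3)) (hx₀ : R / 2 ≤ ‖x₀‖) :
    DifferentiableAt ℝ (vectorStream ω) x₀ ∧
    ‖vectorStream ω x₀‖ ≤ 4 / R * ∫ y, ‖ω y‖ ∧
    ‖fderiv ℝ (vectorStream ω) x₀‖ ≤ 16 / R ^ 2 * ∫ y, ‖ω y‖ := by
  have hRpos : 0 < R := by linarith
  obtain ⟨hint, -⟩ := aux_int R₀ ω hω hs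
  have hpi : ‖(1 / (4 * π) : ℝ)‖ ≤ 1 := by
    rw [Real.norm_of_nonneg (by positivity), div_le_one (by positivity)]
    linarith [Real.pi_gt_three]
  have hI : 0 ≤ ∫ y, ‖ω y‖ := integral_nonneg fun _ => norm_nonneg _
  have far : ∀ x ∈ Metric.ball x₀ R₀, ∀ y, ω y ≠ 0 → R / 4 ≤ ‖x - y‖ := by
    intro x hx y hy
    have h1 : ‖y‖ ≤ R₀ := by simpa using hs hy
    have h2 : ‖x - x₀‖ < R₀ := by simpa [dist_eq_norm] using hx
    have h3 : ‖x₀‖ ≤ ‖x - y‖ + ‖y‖ + ‖x - x₀‖ := by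
      have : x₀ = (x - y) + y - (x - x₀) := by abel
      calc ‖x₀‖ = ‖(x - y) + y - (x - x₀)‖ := by rw [← this]
        _ ≤ ‖(x - y) + y‖ + ‖x - x₀‖ := norm_sub_le _ _
        _ ≤ _ := by gcongr; exact norm_add_le _ _
    linarith
  have hx₀m : x₀ ∈ Metric.ball x₀ R₀ := Metric.mem_ball_self hR₀
  have bF : ∀ y, ‖(1 / ‖x₀ - y‖) • ω y‖ ≤ 4 / R * ‖ω y‖ := by
    intro y
    by_cases hy : ω y = 0
    · simp [hy]
    have := far x₀ hx₀m y hy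
    rw [norm_smul, Real.norm_of_nonneg (by positivity)]
    refine mul_le_mul_of_nonneg_right ?_ (norm_nonneg _)
    rw [show (4 : ℝ) / R = 1 / (R / 4) by field_simp]
    exact one_div_le_one_div_of_le (by positivity) this
  have bF' : ∀ x ∈ Metric.ball x₀ R₀, ∀ y,
      ‖(auxA (x - y)).smulRight (ω y)‖ ≤ 16 / R ^ 2 * ‖ω y‖ := by
    intro x hx y
    rw [ContinuousLinearMap.norm_smulRight_apply]
    by_cases hy : ω y = 0
    · simp [hy]
    have := far x hx y hy
    gcongr
    refine (auxA_norm _).trans ?_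
    rw [show (16 : ℝ) / R ^ 2 = ((R / 4) ^ 2)⁻¹ by field_simp; norm_num]
    gcongr
  have mF : ∀ x, AEStronglyMeasurable (fun y => (1 / ‖x - y‖) • ω y) := by
    intro x
    have h1 : Measurable (fun y : EuclideanSpace ℝ (Fin 3) => 1 / ‖x - y‖) := by fun_prop
    exact (h1.smul hω.measurable).aestronglyMeasurable
  have mF' : AEStronglyMeasurable (fun y => (auxA (x₀ - y)).smulRight (ω y)) := by
    have h1 : Measurable (fun y => auxA (x₀ - y)) :=
      auxA_meas.comp (measurable_const.sub measurable_id)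
    exact aux_meas _ _ _ h1.aestronglyMeasurable hω.aestronglyMeasurable
  have iF : Integrable (fun y => (1 / ‖x₀ - y‖) • ω y) :=
    (hint.norm.const_mul (4 / R)).mono' (mF x₀) (Filter.Eventually.of_forall bF)
  have dF : ∀ y, ∀ x ∈ Metric.ball x₀ R₀, HasFDerivAt (fun x => (1 / ‖x - y‖) • ω y)
      ((auxA (x - y)).smulRight (ω y)) x := fun y x hx =>
    aux_diff x y (ω y) fun hy => by
      rw [← norm_pos_iff]
      linarith [far x hx y hy]
  have hd := hasFDerivAt_integral_of_dominated_of_fderiv_le (𝕜 := ℝ)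
    (F := fun x y => (1 / ‖x - y‖) • ω y)
    (F' := fun x y => (auxA (x - y)).smulRight (ω y)) (μ := volume)
    (bound := fun y => 16 / R ^ 2 * ‖ω y‖)
    (Metric.ball_mem_nhds x₀ hR₀) (Filter.Eventually.of_forall mF) iF mF'
    (Filter.Eventually.of_forall fun y x hx => bF' x hx y) (hint.norm.const_mul _)
    (Filter.Eventually.of_forall dF)
  have hd2 : HasFDerivAt (vectorStream ω) _ x₀ := hd.const_smul (1 / (4 * π) : ℝ)
  refine ⟨hd2.differentiableAt, ?_, ?_⟩
  · unfold vectorStream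
    rw [norm_smul, ← integral_const_mul]
    refine (mul_le_of_le_one_left (norm_nonneg _) hpi).trans ?_
    exact norm_integral_le_of_norm_le (hint.norm.const_mul _) (Filter.Eventually.of_forall bF)
  · rw [hd2.fderiv, norm_smul, ← integral_const_mul]
    refine (mul_le_of_le_one_left (norm_nonneg _) hpi).trans ?_
    exact norm_integral_le_of_norm_le (hint.norm.const_mul _)
      (Filter.Eventually.of_forall (bF' x₀ hx₀m))

lemma aux_holder (R₀ : ℝ)
    (ω : EuclideanSpace ℝ (Fin 3) → EuclideanSpace ℝ (Fin 3)) (hω : Continuous ω)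
    (hs : Function.support ω ⊆ Metric.closedBall 0 R₀) :
    ∫ y, ‖ω y‖ ≤ √(∫ y, ‖ω y‖ ^ 2) *
      √((volume (Metric.closedBall (0 : EuclideanSpace ℝ (Fin 3)) R₀)).toReal) := by
  obtain ⟨hint, hc⟩ := aux_int R₀ ω hω hs
  set B := Metric.closedBall (0 : EuclideanSpace ℝ (Fin 3)) R₀
  have hB : MeasurableSet B := measurableSet_closedBall
  have hBf : volume B ≠ ⊤ := measure_closedBall_lt_top.ne
  have h := integral_mul_le_Lp_mul_Lq_of_nonneg (μ := volume) Real.HolderConjugate.two_two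
    (f := fun y => ‖ω y‖) (g := B.indicator (fun _ => (1 : ℝ)))
    (Filter.Eventually.of_forall fun _ => norm_nonneg _)
    (Filter.Eventually.of_forall fun _ => Set.indicator_nonneg (fun _ _ => zero_le_one) _)
    ((hω.memLp_of_hasCompactSupport hc).norm)
    (memLp_indicator_const _ hB _ (Or.inr hBf))
  have e1 : ∀ y, ‖ω y‖ * B.indicator (fun _ => (1 : ℝ)) y = ‖ω y‖ := by
    intro y
    by_cases hy : y ∈ B
    · simp [hy]
    · have : ω y = 0 := by by_contra h0; exact hy (hs h0)
      simp [this]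
  have e2 : ∀ y, B.indicator (fun _ => (1 : ℝ)) y ^ (2 : ℝ) = B.indicator (fun _ => (1 : ℝ)) y := by
    intro y
    by_cases hy : y ∈ B <;> simp [hy]
  simp only [e1, e2] at h
  rw [integral_indicator_const _ hB, ← Real.sqrt_eq_rpow, ← Real.sqrt_eq_rpow] at h
  simpa [Measure.real] using h

lemma aux_point (R₀ R K : ℝ) (hR₀ : 0 < R₀) (hK : 0 < K) (hR : 8 * R₀ ≤ R)
    (ω : EuclideanSpace ℝ (Fin 3) → EuclideanSpace ℝ (Fin 3)) (hω : Continuous ω)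
    (hs : Function.support ω ⊆ Metric.closedBall 0 R₀)
    (f : EuclideanSpace ℝ (Fin 3) → ℝ) (hf : ContDiff ℝ (⊤ : ℕ∞) f)
    (h01 : ∀ x, f x ∈ Set.Icc (0:ℝ) 1)
    (h1 : ∀ x : EuclideanSpace ℝ (Fin 3), ‖x‖ ≤ R / 2 → f x = 1)
    (hD : ∀ x, ‖fderiv ℝ f x‖ ≤ K / R) (x : EuclideanSpace ℝ (Fin 3)) :
    ‖curl3 (vectorStream ω) x - curl3 (fun z => f z • vectorStream ω z) x‖ ≤
      (4 * (16 + 4 * K)) / R ^ 2 * ∫ y, ‖ω y‖ := by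
  have hRpos : 0 < R := by linarith
  have hI : 0 ≤ ∫ y, ‖ω y‖ := integral_nonneg fun _ => norm_nonneg _
  refine (aux_curl _ _ x).trans ?_
  rcases lt_or_ge ‖x‖ (R / 2) with hx | hx
  · have : vectorStream ω =ᶠ[nhds x] (fun z => f z • vectorStream ω z) := by
      have := (isOpen_lt continuous_norm continuous_const).mem_nhds hx
      filter_upwards [this] with z hz
      rw [h1 z (le_of_lt hz), one_smul]
    rw [this.fderiv_eq, sub_self, norm_zero, mul_zero]
    positivity
  · obtain ⟨hd, hb, hb'⟩ := aux_pot R₀ R hR₀ hR ω hω hs x hx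
    have hfd : DifferentiableAt ℝ f x := (hf.differentiable (by simp)) x
    have e : fderiv ℝ (fun z => f z • vectorStream ω z) x =
        f x • fderiv ℝ (vectorStream ω) x + (fderiv ℝ f x).smulRight (vectorStream ω x) :=
      fderiv_fun_smul hfd hd
    have e2 : fderiv ℝ (vectorStream ω) x - fderiv ℝ (fun z => f z • vectorStream ω z) x =
        (1 - f x) • fderiv ℝ (vectorStream ω) x - (fderiv ℝ f x).smulRight (vectorStream ω x) := by
      rw [e]; module
    have hh := h01 x
    have n1 : ‖(1 - f x) • fderiv ℝ (vectorStream ω) x‖ ≤ 16 / R ^ 2 * ∫ y, ‖ω y‖ := by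
      rw [norm_smul, Real.norm_of_nonneg (by linarith [hh.2])]
      exact (mul_le_of_le_one_left (norm_nonneg _) (by linarith [hh.1])).trans hb'
    have n2 : ‖(fderiv ℝ f x).smulRight (vectorStream ω x)‖ ≤ K / R * (4 / R * ∫ y, ‖ω y‖) := by
      rw [ContinuousLinearMap.norm_smulRight_apply]
      exact mul_le_mul (hD x) hb (norm_nonneg _) (by positivity)
    rw [e2]
    calc _ ≤ 4 * (16 / R ^ 2 * (∫ y, ‖ω y‖) + K / R * (4 / R * ∫ y, ‖ω y‖)) := by
          gcongr; exact (norm_sub_le _ _).trans (add_le_add n1 n2)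
      _ = _ := by field_simp

theorem truncation3D_L2_velocity (R₀ K : ℝ) (hR₀ : 0 < R₀) (hK : 0 < K) :
    ∃ C > 0, ∀ ω : EuclideanSpace ℝ (Fin 3) → EuclideanSpace ℝ (Fin 3),
      Continuous ω →
      Function.support ω ⊆ Metric.closedBall 0 R₀ →
      ∀ φ : ℝ → EuclideanSpace ℝ (Fin 3) → ℝ,
      (∀ R : ℝ, 0 < R →
        ContDiff ℝ (⊤ : ℕ∞) (φ R) ∧
        (∀ x, φ R x ∈ Set.Icc (0:ℝ) 1) ∧
        (∀ x : EuclideanSpace ℝ (Fin 3), ‖x‖ ≤ R / 2 → φ R x = 1) ∧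
        (∀ x : EuclideanSpace ℝ (Fin 3), R ≤ ‖x‖ → φ R x = 0) ∧
        (∀ x, ‖fderiv ℝ (φ R) x‖ ≤ K / R)) →
      ∀ R : ℝ, 8 * R₀ ≤ R →
        eLpNorm
            (fun x => curl3 (vectorStream ω) x -
              curl3 (fun z => φ R z • vectorStream ω z) x) 2
            (volume.restrict (Metric.ball 0 R)) ≤
          ENNReal.ofReal
            (C * Real.sqrt (∫ y, ‖ω y‖ ^ 2) * R ^ (-(1/2 : ℝ))) := by
  set V := (volume (Metric.ball (0 : EuclideanSpace ℝ (Fin 3)) 1)).toReal with hV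
  set W := (volume (Metric.closedBall (0 : EuclideanSpace ℝ (Fin 3)) R₀)).toReal with hW
  refine ⟨√V * (4 * (16 + 4 * K)) * √W + 1, by positivity, ?_⟩
  intro ω hω hs φ hφ R hR
  have hRpos : 0 < R := by linarith
  obtain ⟨hf, h01, h1, -, hD⟩ := hφ R hRpos
  have hp := aux_point R₀ R K hR₀ hK hR ω hω hs (φ R) hf h01 h1 hD
  refine (eLpNorm_le_of_ae_bound (Filter.Eventually.of_forall hp)).trans ?_
  rw [Measure.restrict_apply_univ, Measure.addHaar_ball _ _ hRpos.le,
    ← ENNReal.ofReal_toReal (measure_ball_lt_top (μ := volume)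
      (x := (0 : EuclideanSpace ℝ (Fin 3))) (r := 1)).ne, ← hV,
    ← ENNReal.ofReal_mul (by positivity),
    ENNReal.ofReal_rpow_of_nonneg (by positivity) (by positivity),
    ← ENNReal.ofReal_mul (by positivity)]
  apply ENNReal.ofReal_le_ofReal
  have hH := aux_holder R₀ ω hω hs
  rw [← hW] at hH
  set S := √(∫ y, ‖ω y‖ ^ 2)
  have eV : (R ^ Module.finrank ℝ (EuclideanSpace ℝ (Fin 3)) * V) ^ (2 : ENNReal).toReal⁻¹ =
      R ^ (3 / 2 : ℝ) * √V := by
    rw [finrank_euclideanSpace_fin, Real.mul_rpow (by positivity) (by positivity),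
      Real.sqrt_eq_rpow, ← Real.rpow_natCast, ← Real.rpow_mul hRpos.le]
    norm_num
  have eR : R ^ (3 / 2 : ℝ) / R ^ 2 = R ^ (-(1 / 2) : ℝ) := by
    rw [← Real.rpow_natCast, ← Real.rpow_sub hRpos]; norm_num
  rw [eV]
  calc R ^ (3 / 2 : ℝ) * √V * (4 * (16 + 4 * K) / R ^ 2 * ∫ y, ‖ω y‖)
      ≤ R ^ (3 / 2 : ℝ) * √V * (4 * (16 + 4 * K) / R ^ 2 * (S * √W)) := by gcongr
    _ = (√V * (4 * (16 + 4 * K)) * √W) * S * (R ^ (3 / 2 : ℝ) / R ^ 2) := by ring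
    _ = (√V * (4 * (16 + 4 * K)) * √W) * S * R ^ (-(1 / 2) : ℝ) := by rw [eR]
    _ ≤ _ := by gcongr; linarith
end
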